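/- arXiv:2602.23025 — 3 statements merged into one kernel-verified Lean document; each statement's English description precedes it below -/
import Mathlib

section
/- Let p ∈ ℕ and let g : (0,∞) → ℝ lie in D^p ∩ K^p. Then there exists f : (0,∞) → ℝ lying in K^p with f(1) = 0 and Δf = g on (0,∞); moreover, for every x > 0, f(x) = lim_{n→∞} [ Σ_{k=1}^{n−1} g(k) − Σ_{k=0}^{n−1} g(x+k) + Σ_{j=1}^{p} C(x,j)·Δ^{j−1} g(n) ]. -/
open Finset Filter

/-- Forward difference operator: `Δ f x = f (x + 1) - f x`. -/
noncomputable def fdiff (f : ℝ → ℝ) : ℝ → ℝ := fun x => f (x + 1) - f x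

/-- Generalized binomial coefficient `C(x, j) = x (x-1) ⋯ (x-j+1) / j!`. -/
noncomputable def gbinom (x : ℝ) (j : ℕ) : ℝ :=
  (∏ i ∈ Finset.range j, (x - i)) / (Nat.factorial j)

/-- Divided difference of `f` at the points `x 0, …, x (n-1)`. -/
noncomputable def divDiff (f : ℝ → ℝ) {n : ℕ} (x : Fin n → ℝ) : ℝ :=
  ∑ i, f (x i) / ∏ j ∈ Finset.univ.erase i, (x i - x j)

/-- `f` is `p`-convex on the set `S`: every divided difference of `f`
at `p + 2` pairwise distinct points of `S` is nonnegative. -/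
def ConvexOrderOn (f : ℝ → ℝ) (p : ℕ) (S : Set ℝ) : Prop :=
  ∀ x : Fin (p + 2) → ℝ, (∀ i, x i ∈ S) → Function.Injective x → 0 ≤ divDiff f x

/-- The class `K^p`: functions that are eventually `p`-convex or eventually `p`-concave. -/
def EvK (p : ℕ) (f : ℝ → ℝ) : Prop :=
  (∃ a > (0 : ℝ), ConvexOrderOn f p (Set.Ioi a)) ∨
    (∃ a > (0 : ℝ), ConvexOrderOn (fun x => -f x) p (Set.Ioi a))

/-- The class `D^p`: functions with `Δ^p f (n) → 0` as `n → ∞` along the integers. -/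
def DD (p : ℕ) (f : ℝ → ℝ) : Prop :=
  Filter.Tendsto (fun n : ℕ => (fdiff^[p] f) n) Filter.atTop (nhds 0)

/-- The digamma function `ψ = Γ'/Γ`. -/
noncomputable def digamma (x : ℝ) : ℝ := deriv Real.Gamma x / Real.Gamma x

/-- A multiple-gamma sequence: `G 0 = id`, `G (m+1) (x+1) = G m x * G (m+1) x`,
`G m 1 = 1`, each `G m` is positive and `C^∞` on `(0,∞)`, and the `m`-th derivative
of `ln ∘ G m` is increasing on `(0,∞)`. -/
def IsMultipleGammaSeq (G : ℕ → ℝ → ℝ) : Prop :=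
  (∀ m, ∀ x > (0 : ℝ), 0 < G m x) ∧
  (∀ m, ContDiffOn ℝ (⊤ : ℕ∞) (G m) (Set.Ioi 0)) ∧
  (∀ x > (0 : ℝ), G 0 x = x) ∧
  (∀ m, ∀ x > (0 : ℝ), G (m + 1) (x + 1) = G m x * G (m + 1) x) ∧
  (∀ m, G m 1 = 1) ∧
  (∀ m, StrictMonoOn
    (iteratedDerivWithin m (fun x => Real.log (G m x)) (Set.Ioi 0)) (Set.Ioi 0))

/-- The divided difference of `f` at the points of a finite set. -/
noncomputable def setDivDiff (f : ℝ → ℝ) (s : Finset ℝ) : ℝ :=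
  ∑ a ∈ s, f a / ∏ b ∈ s.erase a, (a - b)

/-- The points `y, y + 1, …, y + k - 1`. -/
noncomputable def unitNodes (y : ℝ) (k : ℕ) : Finset ℝ :=
  (range k).image (fun i : ℕ => y + i)

/-- The error of the degree `< k` Newton interpolation of `g` at `y, y + 1, …`,
evaluated at `y + x`. -/
noncomputable def newtonRem (g : ℝ → ℝ) (k : ℕ) (y x : ℝ) : ℝ :=
  g (x + y) - ∑ j ∈ range k, gbinom x j * (fdiff^[j] g) y

lemma divDiff_eq_setDivDiff (f : ℝ → ℝ) {n : ℕ} {x : Fin n → ℝ} (hx : Function.Injective x) :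
    divDiff f x = setDivDiff f (univ.image x) := by
  unfold divDiff setDivDiff
  rw [sum_image (fun _ _ _ _ h => hx h)]
  refine sum_congr rfl fun i _ => ?_
  rw [← image_erase hx, prod_image (fun _ _ _ _ h => hx h)]

lemma convexOrderOn_iff (f : ℝ → ℝ) (p : ℕ) (S : Set ℝ) :
    ConvexOrderOn f p S ↔
      ∀ s : Finset ℝ, ↑s ⊆ S → #s = p + 2 → 0 ≤ setDivDiff f s := by
  constructor
  · intro h s hs hc
    have hinj : Function.Injective (s.orderEmbOfFin hc) := (s.orderEmbOfFin hc).injective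
    have := h (s.orderEmbOfFin hc) (fun i => hs (s.orderEmbOfFin_mem hc i)) hinj
    rwa [divDiff_eq_setDivDiff f hinj, image_orderEmbOfFin_univ] at this
  · intro h x hxS hx
    rw [divDiff_eq_setDivDiff f hx]
    refine h _ ?_ ?_
    · intro y hy
      simp only [coe_image, coe_univ, Set.image_univ, Set.mem_range] at hy
      obtain ⟨i, rfl⟩ := hy
      exact hxS i
    · rw [card_image_of_injective _ hx, card_univ, Fintype.card_fin]

lemma setDivDiff_insert_sub_insert (f : ℝ → ℝ) (s : Finset ℝ) {u v : ℝ} (hu : u ∉ s)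
    (hv : v ∉ s) (huv : u ≠ v) :
    setDivDiff f (insert u s) - setDivDiff f (insert v s) =
      (u - v) * setDivDiff f (insert u (insert v s)) := by
  have huv' : u - v ≠ 0 := sub_ne_zero.2 huv
  have hvu' : v - u ≠ 0 := sub_ne_zero.2 huv.symm
  have huvs : u ∉ insert v s := by simp [huv, hu]
  have expand : ∀ w t, w ∉ t → setDivDiff f (insert w t) =
      f w / ∏ b ∈ t, (w - b) + ∑ a ∈ t, f a / ((a - w) * ∏ b ∈ t.erase a, (a - b)) := by
    intro w t hw
    unfold setDivDiff
    rw [sum_insert hw, erase_insert hw]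
    congr 1
    refine sum_congr rfl fun a ha => ?_
    have haw : w ≠ a := fun h => hw (h ▸ ha)
    rw [erase_insert_of_ne haw, prod_insert (by simp [hw])]
  rw [expand u s hu, expand v s hv, expand u _ huvs, sum_insert hv, erase_insert hv,
    prod_insert hv, mul_add, mul_add, mul_sum]
  have hsum : ∑ a ∈ s, (u - v) * (f a / ((a - u) * ∏ b ∈ (insert v s).erase a, (a - b))) =
      ∑ a ∈ s, f a / ((a - u) * ∏ b ∈ s.erase a, (a - b)) -
        ∑ a ∈ s, f a / ((a - v) * ∏ b ∈ s.erase a, (a - b)) := by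
    rw [← sum_sub_distrib]
    refine sum_congr rfl fun a ha => ?_
    have hav : v ≠ a := fun h => hv (h ▸ ha)
    have hau : u ≠ a := fun h => hu (h ▸ ha)
    rw [erase_insert_of_ne hav, prod_insert (by simp [hv])]
    have h1 : a - v ≠ 0 := sub_ne_zero.2 hav.symm
    have h2 : a - u ≠ 0 := sub_ne_zero.2 hau.symm
    have h3 : ∏ b ∈ s.erase a, (a - b) ≠ 0 :=
      prod_ne_zero_iff.2 fun b hb => sub_ne_zero.2 (ne_of_mem_erase hb).symm
    field_simp
    ring
  rw [hsum]
  have h4 : ∏ b ∈ s, (u - b) ≠ 0 :=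
    prod_ne_zero_iff.2 fun b hb => sub_ne_zero.2 fun h => hu (h ▸ hb)
  have h5 : ∏ b ∈ s, (v - b) ≠ 0 :=
    prod_ne_zero_iff.2 fun b hb => sub_ne_zero.2 fun h => hv (h ▸ hb)
  have e1 : (u - v) * (f u / ((u - v) * ∏ b ∈ s, (u - b))) = f u / ∏ b ∈ s, (u - b) := by
    field_simp
  have e2 : (u - v) * (f v / ((v - u) * ∏ b ∈ s, (v - b))) = - (f v / ∏ b ∈ s, (v - b)) := by
    field_simp
    ring
  rw [e1, e2]
  ring

lemma mem_unitNodes {y : ℝ} {k : ℕ} {z : ℝ} :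
    z ∈ unitNodes y k ↔ ∃ i < k, y + (i : ℝ) = z := by
  simp [unitNodes]

lemma unitNodes_succ (y : ℝ) (k : ℕ) :
    unitNodes y (k + 1) = insert (y + k) (unitNodes y k) := by
  simp [unitNodes, range_add_one, image_insert]

lemma unitNodes_succ' (y : ℝ) (k : ℕ) :
    unitNodes y (k + 1) = insert y (unitNodes (y + 1) k) := by
  ext z
  rw [mem_insert, mem_unitNodes, mem_unitNodes]
  constructor
  · rintro ⟨i, hi, rfl⟩
    rcases i with _ | i
    · simp
    · exact Or.inr ⟨i, by omega, by push_cast; ring⟩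
  · rintro (rfl | ⟨i, hi, rfl⟩)
    · exact ⟨0, by omega, by simp⟩
    · exact ⟨i + 1, by omega, by push_cast; ring⟩

lemma card_unitNodes (y : ℝ) (k : ℕ) : #(unitNodes y k) = k := by
  rw [unitNodes, card_image_of_injective, card_range]
  intro i j h
  simpa using h

lemma notMem_unitNodes_add_one (y : ℝ) (k : ℕ) : y ∉ unitNodes (y + 1) k := by
  rw [mem_unitNodes]
  rintro ⟨i, -, h⟩
  have : (0 : ℝ) ≤ i := i.cast_nonneg
  linarith

lemma add_notMem_unitNodes (y : ℝ) (k : ℕ) : y + k ∉ unitNodes y k := by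
  rw [mem_unitNodes]
  rintro ⟨i, hi, h⟩
  have : (i : ℝ) < k := by exact_mod_cast hi
  linarith

lemma setDivDiff_unitNodes (f : ℝ → ℝ) (k : ℕ) (y : ℝ) :
    setDivDiff f (unitNodes y (k + 1)) = (fdiff^[k] f) y / (Nat.factorial k) := by
  induction k generalizing y with
  | zero => simp [setDivDiff, unitNodes]
  | succ k ih =>
    have hins : y + 1 + k ∉ unitNodes (y + 1) k := add_notMem_unitNodes _ _
    have hk : (0 : ℝ) < k + 1 := by positivity
    have h := setDivDiff_insert_sub_insert f (unitNodes (y + 1) k) hins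
      (notMem_unitNodes_add_one y k) (by linarith)
    rw [← unitNodes_succ, ← unitNodes_succ', ih, ih, unitNodes_succ' y k, insert_comm,
      ← unitNodes_succ, ← unitNodes_succ'] at h
    have e : y + 1 + k - y = (k + 1 : ℝ) := by ring
    rw [e] at h
    rw [Function.iterate_succ_apply', fdiff, Nat.factorial_succ]
    have h3 : (Nat.factorial k : ℝ) ≠ 0 := by positivity
    push_cast
    rw [← sub_div, div_eq_iff h3] at h
    rw [h]
    field_simp

lemma gbinom_natCast (m j : ℕ) : gbinom m j = m.choose j := by
  have h : ∏ i ∈ range j, ((m : ℝ) - i) = m.descFactorial j := by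
    induction j with
    | zero => simp
    | succ j ih =>
      rw [prod_range_succ, ih, Nat.descFactorial_succ]
      rcases le_or_gt j m with hjm | hjm
      · push_cast [hjm]
        ring
      · simp [Nat.descFactorial_eq_zero_iff_lt.2 hjm]
  rw [gbinom, h, Nat.descFactorial_eq_factorial_mul_choose]
  have : (Nat.factorial j : ℝ) ≠ 0 := by positivity
  push_cast
  field_simp

lemma newtonRem_natCast (g : ℝ → ℝ) {k m : ℕ} (hm : m < k) (y : ℝ) :
    newtonRem g k y m = 0 := by
  have h := shift_eq_sum_fwdDiff_iter (h := (1 : ℝ)) g m y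
  have hfd : fwdDiff (1 : ℝ) = (fdiff : (ℝ → ℝ) → ℝ → ℝ) := rfl
  rw [hfd] at h
  have hsub : range (m + 1) ⊆ range k := range_subset_range.2 hm
  rw [newtonRem, add_comm, sub_eq_zero]
  simp only [nsmul_eq_mul, mul_one] at h
  rw [h, sum_subset hsub]
  · exact sum_congr rfl fun j _ => by rw [gbinom_natCast]
  · intro j _ hj
    rw [Nat.choose_eq_zero_of_lt (by simpa using hj)]
    simp

lemma add_notMem_unitNodes_of_ne {k : ℕ} {x : ℝ} (hx : ∀ m < k, x ≠ (m : ℕ)) (y : ℝ) :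
    x + y ∉ unitNodes y k := by
  rw [mem_unitNodes]
  rintro ⟨i, hi, h⟩
  exact hx i hi (by linarith)

lemma newtonRem_eq (g : ℝ → ℝ) (k : ℕ) (y : ℝ) {x : ℝ} (hx : ∀ m < k, x ≠ (m : ℕ)) :
    newtonRem g k y x =
      (∏ i ∈ range k, (x - i)) * setDivDiff g (insert (x + y) (unitNodes y k)) := by
  induction k with
  | zero => simp [newtonRem, setDivDiff, unitNodes]
  | succ k ih =>
    have hx' : ∀ m < k, x ≠ (m : ℕ) := fun m hm => hx m (by omega)
    have h := setDivDiff_insert_sub_insert g (unitNodes y k) (add_notMem_unitNodes_of_ne hx' y)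
      (add_notMem_unitNodes y k) (fun h => hx k (by omega) (by linarith))
    rw [← unitNodes_succ, setDivDiff_unitNodes] at h
    have e : newtonRem g (k + 1) y x = newtonRem g k y x - gbinom x k * (fdiff^[k] g) y := by
      rw [newtonRem, sum_range_succ, newtonRem]
      ring
    rw [e, ih hx', prod_range_succ, gbinom]
    linear_combination (∏ i ∈ range k, (x - i)) * h

lemma setDivDiff_union_le {f : ℝ → ℝ} {p : ℕ} {S : Set ℝ} (hf : ConvexOrderOn f p S)
    (A : Finset ℝ) : ∀ B C : Finset ℝ, #A = #B → #C + #A = p + 1 → Disjoint C A → Disjoint C B →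
      (∀ a ∈ A, ∀ b ∈ B, a < b) → ↑A ⊆ S → ↑B ⊆ S → ↑C ⊆ S →
      setDivDiff f (C ∪ A) ≤ setDivDiff f (C ∪ B) := by
  rw [convexOrderOn_iff] at hf
  induction A using Finset.induction_on with
  | empty =>
    intro B C hB _ _ _ _ _ _ _
    rw [card_empty] at hB
    rw [card_eq_zero.1 hB.symm]
  | insert a A ha ih =>
    intro B' C hB hC hCA hCB hlt hAS hBS hCS
    rw [card_insert_of_notMem ha] at hB hC
    obtain ⟨b, hb⟩ : B'.Nonempty := card_pos.1 (by omega)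
    obtain ⟨B, hbB, rfl⟩ : ∃ B, b ∉ B ∧ insert b B = B' :=
      ⟨B'.erase b, notMem_erase _ _, insert_erase hb⟩
    rw [card_insert_of_notMem hbB] at hB
    rw [disjoint_insert_right] at hCA hCB
    have hab : a < b := hlt a (mem_insert_self _ _) b (mem_insert_self _ _)
    have hbA : b ∉ A := fun h =>
      lt_irrefl b (hlt b (mem_insert_of_mem h) b (mem_insert_self _ _))
    rw [coe_insert, Set.insert_subset_iff] at hAS hBS
    have hbU : b ∉ C ∪ A := by simp [hCB.1, hbA]
    have haU : a ∉ C ∪ A := by simp [hCA.1, ha]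
    have hcard : #(C ∪ A) = p := by
      rw [card_union_of_disjoint hCA.2]; omega
    have step := setDivDiff_insert_sub_insert f (C ∪ A) hbU haU hab.ne'
    have hnn : 0 ≤ setDivDiff f (insert b (insert a (C ∪ A))) := by
      apply hf
      · simp only [coe_insert, coe_union, Set.insert_subset_iff, Set.union_subset_iff]
        exact ⟨hBS.1, hAS.1, hCS, hAS.2⟩
      · rw [card_insert_of_notMem (by simp [hab.ne', hCB.1, hbA]), card_insert_of_notMem haU,
          hcard]
    have hmul : 0 ≤ (b - a) * setDivDiff f (insert b (insert a (C ∪ A))) :=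
      mul_nonneg (by linarith) hnn
    have hrec := ih B (insert b C) (by omega)
      (by rw [card_insert_of_notMem hCB.1]; omega)
      (disjoint_insert_left.2 ⟨hbA, hCA.2⟩) (disjoint_insert_left.2 ⟨hbB, hCB.2⟩)
      (fun a' ha' b' hb' => hlt a' (mem_insert_of_mem ha') b' (mem_insert_of_mem hb'))
      hAS.2 hBS.2 (by
        rw [coe_insert, Set.insert_subset_iff]
        exact ⟨hBS.1, hCS⟩)
    rw [insert_union, insert_union] at hrec
    rw [union_insert, union_insert]
    linarith

lemma setDivDiff_le_of_lt {f : ℝ → ℝ} {p : ℕ} {S : Set ℝ} (hf : ConvexOrderOn f p S)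
    {A B : Finset ℝ} (hA : #A = p + 1) (hB : #B = p + 1) (hlt : ∀ a ∈ A, ∀ b ∈ B, a < b)
    (hAS : ↑A ⊆ S) (hBS : ↑B ⊆ S) : setDivDiff f A ≤ setDivDiff f B := by
  simpa using setDivDiff_union_le hf A B ∅ (by omega) (by simpa using hA) (by simp) (by simp)
    hlt hAS hBS (by simp)

lemma setDivDiff_unitNodes_mono {f : ℝ → ℝ} {p : ℕ} {a : ℝ} (hf : ConvexOrderOn f p (Set.Ioi a))
    {s : Finset ℝ} (hs : #s = p + 1) (hsa : ∀ z ∈ s, a < z) {y : ℝ} (hy : ∀ z ∈ s, z < y) :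
    setDivDiff f s ≤ (fdiff^[p] f) y / (Nat.factorial p) := by
  rw [← setDivDiff_unitNodes]
  have key : ∀ z ∈ s, ∀ b ∈ unitNodes y (p + 1), z < b := by
    intro z hz b hb
    obtain ⟨i, -, rfl⟩ := mem_unitNodes.1 hb
    have : (0 : ℝ) ≤ i := i.cast_nonneg
    linarith [hy z hz]
  refine setDivDiff_le_of_lt hf hs (card_unitNodes _ _) key hsa ?_
  intro b hb
  obtain ⟨z, hz⟩ : s.Nonempty := card_pos.1 (by omega)
  exact (hsa z hz).trans (key z hz b hb)

lemma abs_newtonRem_le {g : ℝ → ℝ} {p : ℕ} {a : ℝ} (hg : ConvexOrderOn g p (Set.Ioi a))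
    {x y : ℝ} (hx : 0 < x) (hy : a < y) {m : ℕ} (hpm : p < m) (hxm : x < m) :
    |newtonRem g (p + 1) y x| ≤ |∏ i ∈ range p, (x - (i + 1 : ℕ))| / (Nat.factorial p) *
      ((fdiff^[p] g) (y + m) - (fdiff^[p] g) y) := by
  have hnodes : ∀ z ∈ unitNodes y (p + 1), y ≤ z ∧ z < y + m := by
    intro z hz
    obtain ⟨i, hi, rfl⟩ := mem_unitNodes.1 hz
    have h0 : (0 : ℝ) ≤ i := i.cast_nonneg
    have h1 : (i : ℝ) < m := by exact_mod_cast (by omega : i < m)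
    constructor <;> linarith
  have hfac : (0 : ℝ) < Nat.factorial p := by positivity
  by_cases hxn : ∀ k < p + 1, x ≠ (k : ℕ)
  · have hu := add_notMem_unitNodes_of_ne hxn y
    have hrem := newtonRem_eq g (p + 1) y hxn
    rw [unitNodes_succ'] at hu hrem
    rw [mem_insert, not_or] at hu
    have hstep := setDivDiff_insert_sub_insert g _ hu.2 (notMem_unitNodes_add_one y p) hu.1
    rw [← unitNodes_succ', setDivDiff_unitNodes, unitNodes_succ', add_sub_cancel_right] at hstep
    set D := setDivDiff g (insert (x + y) (insert y (unitNodes (y + 1) p))) with hD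
    have hDnn : 0 ≤ D := by
      refine (convexOrderOn_iff g p _).1 hg _ ?_ ?_
      · rw [← unitNodes_succ']
        intro z hz
        rcases mem_insert.1 (mem_coe.1 hz) with rfl | hz
        · exact Set.mem_Ioi.2 (by linarith)
        · exact lt_of_lt_of_le hy (hnodes z hz).1
      · rw [card_insert_of_notMem (by simp [hu.1, hu.2]), ← unitNodes_succ', card_unitNodes]
    have hup : setDivDiff g (insert (x + y) (unitNodes (y + 1) p)) ≤
        (fdiff^[p] g) (y + m) / (Nat.factorial p) := by
      refine setDivDiff_unitNodes_mono hg
        (by rw [card_insert_of_notMem hu.2, card_unitNodes]) ?_ ?_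
      · intro z hz
        rcases mem_insert.1 hz with rfl | hz
        · linarith
        · exact lt_of_lt_of_le hy (hnodes z (by rw [unitNodes_succ']; simp [hz])).1
      · intro z hz
        rcases mem_insert.1 hz with rfl | hz
        · linarith
        · exact (hnodes z (by rw [unitNodes_succ']; simp [hz])).2
    rw [hrem, prod_range_succ', Nat.cast_zero, sub_zero, mul_assoc, abs_mul,
      abs_of_nonneg (mul_nonneg hx.le hDnn), div_mul_eq_mul_div, mul_div_assoc, sub_div]
    exact mul_le_mul_of_nonneg_left (by linarith) (abs_nonneg _)
  · push Not at hxn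
    obtain ⟨k, hk, rfl⟩ := hxn
    rw [newtonRem_natCast g hk, abs_zero]
    have := setDivDiff_unitNodes_mono hg (card_unitNodes y (p + 1))
      (fun z hz => lt_of_lt_of_le hy (hnodes z hz).1) (fun z hz => (hnodes z hz).2)
    rw [setDivDiff_unitNodes, div_le_div_iff_of_pos_right hfac] at this
    exact mul_nonneg (by positivity) (by linarith)

lemma summable_newtonRem {g : ℝ → ℝ} {p : ℕ} {a : ℝ} (hg : ConvexOrderOn g p (Set.Ioi a))
    (hD : DD p g) {x : ℝ} (hx : 0 < x) :
    Summable (fun n : ℕ => newtonRem g (p + 1) n x) := by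
  obtain ⟨m₀, hm₀⟩ := exists_nat_gt x
  set m := m₀ + p + 1 with hm
  have hxm : x < m := by
    rw [hm]; push_cast
    have : (0 : ℝ) ≤ p := p.cast_nonneg
    linarith
  have hpm : p < m := by omega
  obtain ⟨N, hN⟩ := exists_nat_gt a
  set t : ℕ → ℝ := fun n => (fdiff^[p] g) n with ht
  set K : ℝ := |∏ i ∈ range p, (x - (i + 1 : ℕ))| / (Nat.factorial p) with hK
  set F : ℕ → ℝ := fun n => ∑ i ∈ range m, K * t (n + N + i) with hF
  have hFsub : ∀ n, F (n + 1) - F n = K * (t (n + N + m) - t (n + N)) := by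
    intro n
    have h := sum_range_sub (fun i => K * t (n + N + i)) m
    rw [sum_sub_distrib] at h
    rw [add_zero] at h
    rw [mul_sub, ← h, hF]
    exact congrArg₂ _ (sum_congr rfl fun i _ => by congr 2; ring) rfl
  have hbound : ∀ n : ℕ, |newtonRem g (p + 1) ((n + N : ℕ) : ℝ) x| ≤ F (n + 1) - F n := by
    intro n
    have hy : a < ((n + N : ℕ) : ℝ) := by
      push_cast
      have : (0 : ℝ) ≤ n := n.cast_nonneg
      linarith
    have := abs_newtonRem_le hg hx hy hpm hxm
    rw [← Nat.cast_add, ← hK] at this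
    rw [hFsub]
    exact this
  have hFmono : Monotone F :=
    monotone_nat_of_le_succ fun n => sub_nonneg.1 ((abs_nonneg _).trans (hbound n))
  have hFlim : Tendsto F atTop (nhds 0) := by
    have h : ∀ i ∈ range m, Tendsto (fun n => K * t (n + N + i)) atTop (nhds (K * 0)) := by
      intro i _
      have h1 : Tendsto (fun n => t (n + (N + i))) atTop (nhds 0) :=
        (tendsto_add_atTop_iff_nat (N + i)).2 hD
      simpa only [add_assoc] using h1.const_mul K
    simpa using tendsto_finsetSum _ h
  have hsum : Summable fun n => F (n + 1) - F n := by
    refine summable_of_sum_range_le (c := 0 - F 0) (fun n => (abs_nonneg _).trans (hbound n)) ?_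
    intro n
    rw [sum_range_sub]
    linarith [hFmono.ge_of_tendsto hFlim n]
  rw [← summable_nat_add_iff N]
  exact Summable.of_norm_bounded hsum hbound

/-- The sequence whose limit is the principal indefinite sum of `g`. -/
noncomputable def gaussSeq (g : ℝ → ℝ) (p n : ℕ) (x : ℝ) : ℝ :=
  (∑ k ∈ Finset.Icc 1 (n - 1), g k) - (∑ k ∈ Finset.range n, g (x + k)) +
    ∑ j ∈ Finset.Icc 1 p, gbinom x j * (fdiff^[j - 1] g) n

lemma sum_Icc_one_eq_sum_range (h : ℕ → ℝ) (p : ℕ) :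
    ∑ j ∈ Icc 1 p, h j = ∑ j ∈ range p, h (j + 1) := by
  induction p with
  | zero => simp
  | succ p ih => rw [sum_Icc_succ_top (by omega), ih, sum_range_succ]

lemma gaussSeq_eq (g : ℝ → ℝ) (p n : ℕ) (x : ℝ) :
    gaussSeq g p n x = (∑ k ∈ Icc 1 (n - 1), g k) - (∑ k ∈ range n, g (x + k)) +
      ∑ j ∈ range p, gbinom x (j + 1) * (fdiff^[j] g) n := by
  rw [gaussSeq, sum_Icc_one_eq_sum_range (fun j => gbinom x j * (fdiff^[j - 1] g) n)]
  simp only [Nat.add_sub_cancel]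

lemma gaussSeq_succ_sub (g : ℝ → ℝ) (p : ℕ) {n : ℕ} (hn : 1 ≤ n) (x : ℝ) :
    gaussSeq g p (n + 1) x - gaussSeq g p n x = - newtonRem g (p + 1) n x := by
  obtain ⟨n, rfl⟩ : ∃ k, n = k + 1 := ⟨n - 1, by omega⟩
  rw [gaussSeq_eq, gaussSeq_eq, newtonRem, sum_range_succ' _ p, Nat.add_sub_cancel,
    Nat.add_sub_cancel, sum_Icc_succ_top (by omega), sum_range_succ _ (n + 1)]
  have h : ∑ j ∈ range p, gbinom x (j + 1) * (fdiff^[j + 1] g) ((n + 1 : ℕ) : ℝ) =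
      ∑ j ∈ range p, gbinom x (j + 1) * (fdiff^[j] g) ((n + 1 + 1 : ℕ) : ℝ) -
        ∑ j ∈ range p, gbinom x (j + 1) * (fdiff^[j] g) ((n + 1 : ℕ) : ℝ) := by
    rw [← sum_sub_distrib]
    refine sum_congr rfl fun j _ => ?_
    rw [Function.iterate_succ_apply', fdiff, Nat.cast_succ (n + 1)]
    ring
  rw [h]
  simp [gbinom]
  ring

lemma gbinom_add_one_sub (x : ℝ) (k : ℕ) :
    gbinom (x + 1) (k + 1) - gbinom x (k + 1) = gbinom x k := by
  unfold gbinom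
  rw [prod_range_succ', prod_range_succ, Nat.factorial_succ]
  have h : ∏ i ∈ range k, (x + 1 - ((i + 1 : ℕ) : ℝ)) = ∏ i ∈ range k, (x - i) :=
    prod_congr rfl fun i _ => by push_cast; ring
  rw [h]
  have : (Nat.factorial k : ℝ) ≠ 0 := by positivity
  push_cast
  field_simp
  ring

lemma gaussSeq_add_one_sub (g : ℝ → ℝ) (p n : ℕ) (x : ℝ) :
    gaussSeq g p n (x + 1) - gaussSeq g p n x = g x - newtonRem g p n x := by
  rw [gaussSeq_eq, gaussSeq_eq, newtonRem]
  have h1 := sum_range_sub (fun k : ℕ => g (x + k)) n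
  rw [sum_sub_distrib] at h1
  have h2 : ∑ k ∈ range n, g (x + 1 + k) = ∑ k ∈ range n, g (x + (k + 1 : ℕ)) :=
    sum_congr rfl fun k _ => by congr 1; push_cast; ring
  have h3 : ∑ j ∈ range p, gbinom x j * (fdiff^[j] g) n =
      ∑ j ∈ range p, gbinom (x + 1) (j + 1) * (fdiff^[j] g) n -
        ∑ j ∈ range p, gbinom x (j + 1) * (fdiff^[j] g) n := by
    rw [← sum_sub_distrib]
    exact sum_congr rfl fun j _ => by rw [← gbinom_add_one_sub]; ring
  rw [h2, h3]
  simp only [Nat.cast_zero, add_zero] at h1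
  linarith

lemma tendsto_gaussSeq_one {g : ℝ → ℝ} {p : ℕ} (hD : DD p g) :
    Tendsto (fun n => gaussSeq g p n 1) atTop (nhds 0) := by
  rw [← tendsto_add_atTop_iff_nat 1]
  have h1 : ∀ n : ℕ, gaussSeq g p (n + 1) 1 = - g ((n + 1 : ℕ) : ℝ) +
      ∑ j ∈ range p, gbinom 1 (j + 1) * (fdiff^[j] g) ((n + 1 : ℕ) : ℝ) := by
    intro n
    rw [gaussSeq_eq, Nat.add_sub_cancel, sum_Icc_one_eq_sum_range, sum_range_succ]
    have : ∑ k ∈ range n, g (1 + k) = ∑ k ∈ range n, g (k + 1 : ℕ) :=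
      sum_congr rfl fun k _ => by congr 1; push_cast; ring
    rw [this]
    push_cast
    rw [add_comm (1 : ℝ)]
    ring
  simp only [h1]
  rcases p with _ | p
  · have h2 : Tendsto (fun n : ℕ => g ((n + 1 : ℕ) : ℝ)) atTop (nhds 0) :=
      (tendsto_add_atTop_iff_nat (f := fun n : ℕ => g n) 1).2 hD
    simpa using h2.neg
  · have h2 : ∀ j : ℕ, gbinom 1 (j + 1 + 1) = 0 := by
      intro j
      have h := gbinom_natCast 1 (j + 1 + 1)
      rw [Nat.choose_eq_zero_of_lt (by omega)] at h
      simpa using h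
    simp only [sum_range_succ', h2]
    simp [gbinom]

lemma exists_tendsto_gaussSeq {g : ℝ → ℝ} {p : ℕ} {a : ℝ} (hg : ConvexOrderOn g p (Set.Ioi a))
    (hD : DD p g) {x : ℝ} (hx : 0 < x) :
    ∃ l, Tendsto (fun n => gaussSeq g p n x) atTop (nhds l) := by
  have hs := (summable_nat_add_iff 1).2 (summable_newtonRem hg hD hx).neg
  refine ⟨_, (tendsto_add_atTop_iff_nat 1).1
    ((hs.hasSum.tendsto_sum_nat.add_const (gaussSeq g p 1 x)).congr fun n => ?_)⟩
  have h := sum_range_sub (fun i => gaussSeq g p (i + 1) x) n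
  rw [zero_add] at h
  rw [sub_eq_iff_eq_add.1 h.symm]
  congr 1
  exact sum_congr rfl fun i _ => (gaussSeq_succ_sub g p (by omega) x).symm

lemma tendsto_newtonRem {g : ℝ → ℝ} {p : ℕ} {a : ℝ} (hg : ConvexOrderOn g p (Set.Ioi a))
    (hD : DD p g) {x : ℝ} (hx : 0 < x) :
    Tendsto (fun n : ℕ => newtonRem g p n x) atTop (nhds 0) := by
  have h := (summable_newtonRem hg hD hx).tendsto_atTop_zero.add (hD.const_mul (gbinom x p))
  rw [mul_zero, add_zero] at h
  refine h.congr fun n => ?_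
  rw [newtonRem, sum_range_succ, newtonRem]
  ring

lemma setDivDiff_polynomial_eval (P : Polynomial ℝ) {s : Finset ℝ} (hP : P.natDegree + 1 < #s) :
    setDivDiff (fun x => P.eval x) s = 0 := by
  have hdeg : P.degree < #s :=
    lt_of_le_of_lt P.degree_le_natDegree (by exact_mod_cast (by omega : P.natDegree < #s))
  have h := Lagrange.coeff_eq_sum (v := fun z : ℝ => z) Function.injective_id.injOn hdeg
  rw [Polynomial.coeff_eq_zero_of_natDegree_lt (by omega)] at h
  exact h.symm

lemma setDivDiff_comp_add_const (g : ℝ → ℝ) (c : ℝ) (s : Finset ℝ) :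
    setDivDiff (fun x => g (x + c)) s = setDivDiff g (s.image (· + c)) := by
  have hinj : Function.Injective (· + c : ℝ → ℝ) := add_left_injective c
  unfold setDivDiff
  rw [sum_image hinj.injOn]
  refine sum_congr rfl fun a _ => ?_
  rw [← image_erase hinj, prod_image hinj.injOn]
  simp

lemma exists_polynomial_gaussSeq (g : ℝ → ℝ) (p n : ℕ) :
    ∃ P : Polynomial ℝ, P.natDegree ≤ p ∧
      ∀ x, gaussSeq g p n x = P.eval x - ∑ k ∈ range n, g (x + k) := by
  refine ⟨Polynomial.C (∑ k ∈ Icc 1 (n - 1), g k) + ∑ j ∈ range p,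
    Polynomial.C ((fdiff^[j] g) n / (Nat.factorial (j + 1))) *
      ∏ i ∈ range (j + 1), (Polynomial.X - Polynomial.C (i : ℝ)), ?_, fun x => ?_⟩
  · refine Polynomial.natDegree_add_le_of_degree_le
      ((Polynomial.natDegree_C _).le.trans p.zero_le) ?_
    refine Polynomial.natDegree_sum_le_of_forall_le _ _ fun j hj => ?_
    refine (Polynomial.natDegree_C_mul_le _ _).trans ?_
    rw [Polynomial.natDegree_finsetProd_X_sub_C_eq_card, card_range]
    exact Nat.succ_le_of_lt (mem_range.1 hj)
  · rw [gaussSeq_eq]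
    simp only [Polynomial.eval_add, Polynomial.eval_C, Polynomial.eval_finsetSum,
      Polynomial.eval_mul, Polynomial.eval_prod, Polynomial.eval_sub, Polynomial.eval_X]
    have : ∑ j ∈ range p, gbinom x (j + 1) * (fdiff^[j] g) n = ∑ j ∈ range p,
        (fdiff^[j] g) n / (Nat.factorial (j + 1)) * ∏ i ∈ range (j + 1), (x - i) :=
      sum_congr rfl fun j _ => by rw [gbinom]; ring
    rw [this]
    ring

lemma setDivDiff_gaussSeq_nonpos {g : ℝ → ℝ} {p : ℕ} {a : ℝ}
    (hg : ConvexOrderOn g p (Set.Ioi a)) (n : ℕ) {s : Finset ℝ} (hs : ↑s ⊆ Set.Ioi a)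
    (hc : #s = p + 2) : setDivDiff (gaussSeq g p n) s ≤ 0 := by
  obtain ⟨P, hP, h⟩ := exists_polynomial_gaussSeq g p n
  have hlin : setDivDiff (gaussSeq g p n) s = setDivDiff (fun x => P.eval x) s -
      ∑ k ∈ range n, setDivDiff (fun x => g (x + k)) s := by
    unfold setDivDiff
    rw [sum_comm, ← sum_sub_distrib]
    exact sum_congr rfl fun z _ => by rw [h, sub_div, sum_div]
  rw [hlin, setDivDiff_polynomial_eval P (by omega), zero_sub, neg_nonpos]
  refine sum_nonneg fun k _ => ?_
  rw [setDivDiff_comp_add_const]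
  refine (convexOrderOn_iff g p _).1 hg _ ?_ ?_
  · intro z hz
    obtain ⟨w, hw, rfl⟩ := mem_image.1 (mem_coe.1 hz)
    have h1 : a < w := hs hw
    have h2 : (0 : ℝ) ≤ k := k.cast_nonneg
    exact Set.mem_Ioi.2 (by linarith)
  · rw [card_image_of_injective _ (add_left_injective (k : ℝ)), hc]

lemma exists_indefinite_sum_of_convexOrderOn {g : ℝ → ℝ} {p : ℕ} {a : ℝ} (ha : 0 < a)
    (hg : ConvexOrderOn g p (Set.Ioi a)) (hD : DD p g) :
    ∃ f : ℝ → ℝ, ConvexOrderOn (fun x => - f x) p (Set.Ioi a) ∧ f 1 = 0 ∧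
      (∀ x > (0 : ℝ), fdiff f x = g x) ∧
      ∀ x > (0 : ℝ), Tendsto (fun n => gaussSeq g p n x) atTop (nhds (f x)) := by
  have hex : ∀ x : ℝ, ∃ l, 0 < x → Tendsto (fun n => gaussSeq g p n x) atTop (nhds l) := by
    intro x
    by_cases hx : 0 < x
    · obtain ⟨l, hl⟩ := exists_tendsto_gaussSeq hg hD hx
      exact ⟨l, fun _ => hl⟩
    · exact ⟨0, fun h => absurd h hx⟩
  choose f hf using hex
  refine ⟨f, ?_, tendsto_nhds_unique (hf 1 one_pos) (tendsto_gaussSeq_one hD), ?_, hf⟩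
  · rw [convexOrderOn_iff]
    intro s hs hc
    have hlim : Tendsto (fun n => setDivDiff (gaussSeq g p n) s) atTop
        (nhds (setDivDiff f s)) :=
      tendsto_finsetSum _ fun z hz => (hf z (ha.trans (hs hz))).div_const _
    have hle : setDivDiff f s ≤ 0 :=
      le_of_tendsto' hlim fun n => setDivDiff_gaussSeq_nonpos hg n hs hc
    have hneg : setDivDiff (fun x => - f x) s = - setDivDiff f s := by
      simp [setDivDiff, neg_div]
    linarith
  · intro x hx
    have h1 := (hf (x + 1) (by linarith)).sub (hf x hx)
    simp only [gaussSeq_add_one_sub] at h1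
    have h2 := (tendsto_newtonRem hg hD hx).const_sub (g x)
    rw [sub_zero] at h2
    exact tendsto_nhds_unique h1 h2

lemma fdiff_iterate_neg (g : ℝ → ℝ) (k : ℕ) (x : ℝ) :
    (fdiff^[k] (fun y => - g y)) x = - (fdiff^[k] g) x := by
  induction k generalizing x with
  | zero => rfl
  | succ k ih =>
    rw [Function.iterate_succ_apply', Function.iterate_succ_apply', fdiff, fdiff, ih, ih]
    ring

lemma gaussSeq_neg (g : ℝ → ℝ) (p n : ℕ) (x : ℝ) :
    gaussSeq (fun y => - g y) p n x = - gaussSeq g p n x := by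
  simp only [gaussSeq, fdiff_iterate_neg, sum_neg_distrib, mul_neg]
  ring

/-- Existence of the principal indefinite sum together with the analog of Gauss' limit. -/
theorem stmt_2 (p : ℕ) (g : ℝ → ℝ) (hgD : DD p g) (hgK : EvK p g) :
    ∃ f : ℝ → ℝ, EvK p f ∧ f 1 = 0 ∧ (∀ x > (0 : ℝ), fdiff f x = g x) ∧
      ∀ x > (0 : ℝ), Filter.Tendsto (fun n : ℕ =>
        (∑ k ∈ Finset.Icc 1 (n - 1), g k) - (∑ k ∈ Finset.range n, g (x + k)) +
          ∑ j ∈ Finset.Icc 1 p, gbinom x j * (fdiff^[j - 1] g) n)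
        Filter.atTop (nhds (f x)) := by
  rcases hgK with ⟨a, ha, hg⟩ | ⟨a, ha, hg⟩
  · obtain ⟨f, hf, hf1, hfd, hlim⟩ := exists_indefinite_sum_of_convexOrderOn ha hg hgD
    exact ⟨f, Or.inr ⟨a, ha, hf⟩, hf1, hfd, hlim⟩
  · have hD : DD p (fun x => - g x) := by
      have h := hgD.neg
      rw [neg_zero] at h
      exact h.congr fun n => (fdiff_iterate_neg g p n).symm
    obtain ⟨f, hf, hf1, hfd, hlim⟩ := exists_indefinite_sum_of_convexOrderOn ha hg hD
    refine ⟨fun x => - f x, Or.inl ⟨a, ha, hf⟩, by simp [hf1], fun x hx => ?_, fun x hx => ?_⟩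
    · have h := hfd x hx
      unfold fdiff at h ⊢
      linarith
    · have h := (hlim x hx).neg
      simp only [gaussSeq_neg, neg_neg] at h
      exact h
end

section
/- There exists a sequence of functions G_m : (0,∞) → (0,∞) (m ∈ ℕ), each infinitely differentiable, satisfying: G_0(x) = x for all x > 0; G_{m+1}(x+1) = G_m(x)·G_{m+1}(x) for all m ∈ ℕ and x > 0; G_m(1) = 1 for all m ∈ ℕ; and for each m ∈ ℕ the m-th derivative of ln∘G_m is increasing on (0,∞). Moreover, such a sequence is unique. -/
open Finset Filter

/-- `F k` is the `k`-th derivative of `F 0` on `(0,∞)`, for every `k`. -/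
def IsDerivTower (F : ℕ → ℝ → ℝ) : Prop :=
  ∀ k, ∀ x > (0 : ℝ), HasDerivAt (F k) (F (k + 1) x) x

theorem eq_of_hasDerivAt_zero_Ioi {f : ℝ → ℝ} (hf : ∀ x > (0 : ℝ), HasDerivAt f 0 x) :
    ∀ x > (0 : ℝ), ∀ y > (0 : ℝ), f x = f y := by
  intro x hx y hy
  refine isOpen_Ioi.is_const_of_deriv_eq_zero (s := Set.Ioi (0 : ℝ)) isPreconnected_Ioi
    (fun z hz => (hf z hz).differentiableAt.differentiableWithinAt)
    (fun z hz => (hf z hz).deriv) hx hy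

theorem HasDerivAt.congr_of_eqOn_Ioi {f g : ℝ → ℝ} {f' x : ℝ} (h : HasDerivAt f f' x)
    (hx : 0 < x) (hfg : ∀ y > (0 : ℝ), g y = f y) : HasDerivAt g f' x :=
  h.congr_of_eventuallyEq (by filter_upwards [Ioi_mem_nhds hx] with y hy using hfg y hy)

theorem HasDerivAt.shift_one {f : ℝ → ℝ} {f' x : ℝ} (h : HasDerivAt f f' (x + 1)) :
    HasDerivAt (fun y => f (y + 1)) f' x :=
  h.comp_add_const x 1

theorem IsDerivTower.eqOn {F H : ℕ → ℝ → ℝ} (hF : IsDerivTower F) (hH : IsDerivTower H)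
    (h : ∀ x > (0 : ℝ), F 0 x = H 0 x) (k : ℕ) : ∀ x > (0 : ℝ), F k x = H k x := by
  induction k with
  | zero => exact h
  | succ k ih =>
    intro x hx
    exact (hF k x hx).unique ((hH k x hx).congr_of_eqOn_Ioi hx ih)

theorem IsDerivTower.fdiff {F : ℕ → ℝ → ℝ} (hF : IsDerivTower F) :
    IsDerivTower (fun k x => F k (x + 1) - F k x) := fun k x hx =>
  (hF k (x + 1) (by linarith)).shift_one.sub (hF k x hx)

theorem IsDerivTower.sub {F H : ℕ → ℝ → ℝ} (hF : IsDerivTower F) (hH : IsDerivTower H) :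
    IsDerivTower (fun k x => F k x - H k x) := fun k x hx =>
  (hF k x hx).sub (hH k x hx)

theorem IsDerivTower.contDiffOn {F : ℕ → ℝ → ℝ} (hF : IsDerivTower F) :
    ContDiffOn ℝ (⊤ : ℕ∞) (F 0) (Set.Ioi 0) := by
  rw [contDiffOn_infty]
  intro n
  suffices h : ∀ (n k : ℕ), ContDiffOn ℝ n (F k) (Set.Ioi 0) from h n 0
  intro n
  induction n with
  | zero =>
    intro k
    exact contDiffOn_zero.2 fun x hx => (hF k x hx).continuousAt.continuousWithinAt
  | succ n ih =>
    intro k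
    push_cast
    rw [contDiffOn_succ_iff_deriv_of_isOpen isOpen_Ioi]
    refine ⟨fun x hx => (hF k x hx).differentiableAt.differentiableWithinAt, by simp, ?_⟩
    exact (ih (k + 1)).congr fun x hx => (hF k x hx).deriv

theorem ContDiffOn.isDerivTower {f : ℝ → ℝ} (hf : ContDiffOn ℝ (⊤ : ℕ∞) f (Set.Ioi 0)) :
    IsDerivTower (fun k => iteratedDerivWithin k f (Set.Ioi 0)) := by
  intro k x hx
  have h := hf.differentiableOn_iteratedDerivWithin (m := k)
    (by exact_mod_cast WithTop.coe_lt_top _) (uniqueDiffOn_Ioi 0)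
  have hd := (h x hx).hasDerivWithinAt.hasDerivAt (Ioi_mem_nhds hx)
  simpa only [iteratedDerivWithin_succ] using hd

/-- The series `∑ a k / (x + k) ^ s`. -/
noncomputable def shiftedPowSeries (a : ℕ → ℝ) (s : ℕ) (x : ℝ) : ℝ :=
  ∑' k : ℕ, a k / (x + k) ^ s

section ShiftedPowSeries

variable {a : ℕ → ℝ} {s : ℕ}

theorem abs_div_add_pow_le (ha : ∀ k, 0 ≤ a k) {e x : ℝ} (he : 0 < e) (he1 : e ≤ 1)
    (hx : e ≤ x) (k : ℕ) : |a k / (x + k) ^ s| ≤ (e ^ s)⁻¹ * (a k / ((k : ℝ) + 1) ^ s) := by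
  have hk : (0 : ℝ) ≤ k := k.cast_nonneg
  have hxk : e * ((k : ℝ) + 1) ≤ x + k := by nlinarith
  rw [abs_of_nonneg (div_nonneg (ha k) (pow_nonneg (by linarith) _))]
  calc a k / (x + k) ^ s ≤ a k / (e * ((k : ℝ) + 1)) ^ s := by
        have := ha k
        gcongr
    _ = _ := by rw [mul_pow]; field_simp

theorem summable_shiftedPow (ha : ∀ k, 0 ≤ a k)
    (hs : Summable fun k : ℕ => a k / ((k : ℝ) + 1) ^ s) {x : ℝ} (hx : 0 < x) :
    Summable fun k : ℕ => a k / (x + k) ^ s :=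
  Summable.of_norm_bounded (hs.mul_left ((min x 1) ^ s)⁻¹) fun k =>
    abs_div_add_pow_le ha (lt_min hx one_pos) (min_le_right _ _) (min_le_left _ _) k

theorem summable_shiftedPow_one_succ (ha : ∀ k, 0 ≤ a k)
    (hs : Summable fun k : ℕ => a k / ((k : ℝ) + 1) ^ s) :
    Summable fun k : ℕ => a k / ((k : ℝ) + 1) ^ (s + 1) := by
  refine Summable.of_nonneg_of_le (fun k => div_nonneg (ha k) (by positivity)) (fun k => ?_) hs
  have := ha k
  have hk : (1 : ℝ) ≤ k + 1 := by linarith [(k.cast_nonneg : (0 : ℝ) ≤ k)]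
  gcongr
  · omega

theorem hasDerivAt_shiftedPowSeries (ha : ∀ k, 0 ≤ a k)
    (hs : Summable fun k : ℕ => a k / ((k : ℝ) + 1) ^ s) {x : ℝ} (hx : 0 < x) :
    HasDerivAt (shiftedPowSeries a s) (-(s * shiftedPowSeries a (s + 1) x)) x := by
  set e := min (x / 2) 1
  have he0 : 0 < e := lt_min (by linarith) one_pos
  have hex : e < x := (min_le_left _ _).trans_lt (by linarith)
  have hs' := summable_shiftedPow_one_succ ha hs
  have key := hasDerivAt_tsum_of_isPreconnected
    (g := fun (k : ℕ) (y : ℝ) => a k / (y + k) ^ s)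
    (g' := fun (k : ℕ) (y : ℝ) => -(s : ℝ) * (a k / (y + k) ^ (s + 1)))
    ((hs'.mul_left (e ^ (s + 1))⁻¹).mul_left (s : ℝ)) isOpen_Ioi
    (isPreconnected_Ioi (a := e)) ?_ ?_ hex
    (summable_shiftedPow ha hs hx) hex
  · rw [tsum_mul_left] at key
    exact key.congr_deriv (neg_mul _ _)
  · intro k y hy
    have hy0 : 0 < y + k := add_pos_of_pos_of_nonneg (he0.trans hy) k.cast_nonneg
    have h1 : HasDerivAt (fun y : ℝ => (y + k) ^ s) (s * (y + k) ^ (s - 1) * 1) y :=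
      ((hasDerivAt_id y).add_const (k : ℝ)).pow s
    have h2 := (h1.inv (pow_pos hy0 s).ne').const_mul (a k)
    simp only [div_eq_mul_inv]
    refine h2.congr_deriv ?_
    rcases s with _ | s
    · simp
    · simp only [Nat.add_sub_cancel]
      field_simp
      ring
  · intro k y hy
    rw [Real.norm_eq_abs, abs_mul, abs_neg, Nat.abs_cast]
    exact mul_le_mul_of_nonneg_left
      (abs_div_add_pow_le ha he0 (min_le_right _ _) (le_of_lt hy) k) s.cast_nonneg

theorem tendsto_shiftedPowSeries_atTop (ha : ∀ k, 0 ≤ a k)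
    (hs : Summable fun k : ℕ => a k / ((k : ℝ) + 1) ^ s) (hs0 : s ≠ 0) :
    Tendsto (shiftedPowSeries a s) atTop (nhds 0) := by
  have := tendsto_tsum_of_dominated_convergence (𝓕 := atTop)
    (f := fun (x : ℝ) (k : ℕ) => a k / (x + k) ^ s) (g := fun _ => (0 : ℝ))
    (bound := fun k => ((1 : ℝ) ^ s)⁻¹ * (a k / ((k : ℝ) + 1) ^ s)) (hs.mul_left _) ?_ ?_
  · rwa [tsum_zero] at this
  · intro k
    exact Tendsto.const_div_atTop ((tendsto_pow_atTop hs0).comp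
      (tendsto_atTop_add_const_right _ _ tendsto_id)) _
  · filter_upwards [eventually_ge_atTop (1 : ℝ)] with x hx k
    exact abs_div_add_pow_le ha one_pos le_rfl hx k

theorem shiftedPowSeries_pos (ha : ∀ k, 0 ≤ a k) (ha0 : 0 < a 0)
    (hs : Summable fun k : ℕ => a k / ((k : ℝ) + 1) ^ s) {x : ℝ} (hx : 0 < x) :
    0 < shiftedPowSeries a s x :=
  (summable_shiftedPow ha hs hx).tsum_pos
    (fun k => div_nonneg (ha k) (by positivity)) 0 (by simpa using div_pos ha0 (pow_pos hx s))

theorem shiftedPowSeries_sub {b : ℕ → ℝ} (ha : ∀ k, 0 ≤ a k)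
    (hs : Summable fun k : ℕ => a k / ((k : ℝ) + 1) ^ s)
    (hb0 : b 0 = a 0) (hb : ∀ k, b (k + 1) = a (k + 1) - a k) {x : ℝ} (hx : 0 < x) :
    shiftedPowSeries a s (x + 1) - shiftedPowSeries a s x = -shiftedPowSeries b s x := by
  have h1 := summable_shiftedPow ha hs hx
  have h2 := summable_shiftedPow ha hs (show 0 < x + 1 by linarith)
  have e2 : ∀ k : ℕ, b (k + 1) / (x + (k + 1 : ℕ)) ^ s
      = a (k + 1) / (x + (k + 1 : ℕ)) ^ s - a k / (x + 1 + k) ^ s := by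
    intro k
    have : x + 1 + (k : ℝ) = x + (k + 1 : ℕ) := by push_cast; ring
    rw [this, hb, sub_div]
  have h1' := (summable_nat_add_iff 1).2 h1
  have hbs : Summable fun k : ℕ => b k / (x + k) ^ s := by
    rw [← summable_nat_add_iff 1]
    exact (h1'.sub h2).congr fun k => (e2 k).symm
  unfold shiftedPowSeries
  rw [hbs.tsum_eq_zero_add, h1.tsum_eq_zero_add, tsum_congr e2, h1'.tsum_sub h2, hb0]
  ring

end ShiftedPowSeries

/-- Iterated partial sums of the sequence `1, 0, 0, …`. -/
noncomputable def iterPartialSum : ℕ → ℕ → ℝ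
  | 0, k => if k = 0 then 1 else 0
  | m + 1, k => ∑ j ∈ Finset.range (k + 1), iterPartialSum m j

theorem iterPartialSum_nonneg (m k : ℕ) : 0 ≤ iterPartialSum m k := by
  induction m generalizing k with
  | zero => unfold iterPartialSum; split_ifs <;> norm_num
  | succ m ih => exact Finset.sum_nonneg fun j _ => ih j

theorem iterPartialSum_zero_right (m : ℕ) : iterPartialSum m 0 = 1 := by
  induction m with
  | zero => simp [iterPartialSum]
  | succ m ih => simp [iterPartialSum, ih]

theorem iterPartialSum_succ_le (m k : ℕ) : iterPartialSum (m + 1) k ≤ ((k : ℝ) + 1) ^ m := by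
  induction m generalizing k with
  | zero => simp [iterPartialSum]
  | succ m ih =>
    calc iterPartialSum (m + 2) k
        = ∑ j ∈ Finset.range (k + 1), iterPartialSum (m + 1) j := rfl
      _ ≤ ∑ j ∈ Finset.range (k + 1), ((k : ℝ) + 1) ^ m := by
        refine Finset.sum_le_sum fun j hj => (ih j).trans ?_
        have : (j : ℝ) ≤ k := by exact_mod_cast Nat.lt_succ_iff.1 (Finset.mem_range.1 hj)
        gcongr
      _ = ((k : ℝ) + 1) ^ (m + 1) := by
        rw [Finset.sum_const, Finset.card_range, nsmul_eq_mul, pow_succ]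
        push_cast
        ring

theorem summable_iterPartialSum (m j : ℕ) :
    Summable fun k : ℕ => iterPartialSum m k / ((k : ℝ) + 1) ^ (m + 1 + j) := by
  induction j with
  | succ j ih => exact summable_shiftedPow_one_succ (iterPartialSum_nonneg m) ih
  | zero =>
    rcases m with _ | m
    · refine summable_of_ne_finset_zero (s := {0}) fun k hk => ?_
      have : k ≠ 0 := by simpa using hk
      simp [iterPartialSum, this]
    · have hsq : Summable fun k : ℕ => 1 / ((k : ℝ) + 1) ^ 2 := by
        have := (summable_nat_add_iff 1).2 (Real.summable_one_div_nat_pow.2 one_lt_two)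
        simpa using this
      refine Summable.of_nonneg_of_le
        (fun k => div_nonneg (iterPartialSum_nonneg _ k) (by positivity)) (fun k => ?_) hsq
      rw [div_le_div_iff₀ (by positivity) (by positivity)]
      calc iterPartialSum (m + 1) k * ((k : ℝ) + 1) ^ 2
          ≤ ((k : ℝ) + 1) ^ m * ((k : ℝ) + 1) ^ 2 := by
            gcongr
            exact iterPartialSum_succ_le m k
        _ = 1 * ((k : ℝ) + 1) ^ (m + 1 + 1 + 0) := by ring

theorem shiftedPowSeries_iterPartialSum_zero (s : ℕ) (x : ℝ) :
    shiftedPowSeries (iterPartialSum 0) s x = 1 / x ^ s := by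
  unfold shiftedPowSeries
  rw [tsum_eq_single 0 fun k hk => by simp [iterPartialSum, hk]]
  simp [iterPartialSum]

/-- The `(m + 1 + j)`-th derivative of the logarithm of the `m`-th multiple gamma function. -/
noncomputable def polyGammaSeries (m j : ℕ) (x : ℝ) : ℝ :=
  (-1) ^ j * (m + j).factorial * shiftedPowSeries (iterPartialSum m) (m + 1 + j) x

theorem isDerivTower_polyGammaSeries (m : ℕ) : IsDerivTower (polyGammaSeries m) := by
  intro j x hx
  have h := (hasDerivAt_shiftedPowSeries (iterPartialSum_nonneg m)
    (summable_iterPartialSum m j) hx).const_mul ((-1 : ℝ) ^ j * (m + j).factorial)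
  refine h.congr_deriv ?_
  simp only [polyGammaSeries]
  rw [show m + (j + 1) = (m + j) + 1 by ring, Nat.factorial_succ,
    show m + 1 + (j + 1) = m + 1 + j + 1 by ring]
  push_cast
  ring

theorem polyGammaSeries_succ_sub (m j : ℕ) {x : ℝ} (hx : 0 < x) :
    polyGammaSeries (m + 1) j (x + 1) - polyGammaSeries (m + 1) j x
      = polyGammaSeries m (j + 1) x := by
  have h := shiftedPowSeries_sub (b := iterPartialSum m) (iterPartialSum_nonneg (m + 1))
    (summable_iterPartialSum (m + 1) j)
    (by simp [iterPartialSum_zero_right])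
    (fun k => by simp [iterPartialSum, Finset.sum_range_succ _ (k + 1)]) hx
  simp only [polyGammaSeries]
  rw [← mul_sub, h, show m + (j + 1) = m + 1 + j by ring,
    show m + 1 + (j + 1) = m + 1 + 1 + j by ring]
  ring

theorem tendsto_polyGammaSeries_atTop (m j : ℕ) :
    Tendsto (polyGammaSeries m j) atTop (nhds 0) := by
  have := (tendsto_shiftedPowSeries_atTop (iterPartialSum_nonneg m)
    (summable_iterPartialSum m j) (by omega)).const_mul ((-1 : ℝ) ^ j * (m + j).factorial)
  rwa [mul_zero] at this

theorem polyGammaSeries_zero_pos (m : ℕ) {x : ℝ} (hx : 0 < x) : 0 < polyGammaSeries m 0 x := by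
  have := shiftedPowSeries_pos (iterPartialSum_nonneg m) (by simp [iterPartialSum_zero_right])
    (summable_iterPartialSum m 0) hx
  unfold polyGammaSeries
  positivity

theorem exists_hasDerivAt_Ioi {u : ℝ → ℝ} (hu : ContinuousOn u (Set.Ioi 0)) :
    ∃ v : ℝ → ℝ, ∀ x > (0 : ℝ), HasDerivAt v (u x) x := by
  refine ⟨fun x => ∫ t in (1 : ℝ)..x, u t, fun x hx => ?_⟩
  have hsub : Set.uIcc 1 x ⊆ Set.Ioi 0 := fun t ht =>
    (lt_min one_pos hx).trans_le ht.1
  exact intervalIntegral.integral_hasDerivAt_right (hu.mono hsub).intervalIntegrable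
    (hu.stronglyMeasurableAtFilter isOpen_Ioi x hx) (hu.continuousAt (Ioi_mem_nhds hx))

/-- Antiderivatives of solutions of a difference equation solve the integrated
equation up to a constant. -/
theorem exists_fdiff_sub_eq_const {v u g g' : ℝ → ℝ} (hv : ∀ x > (0 : ℝ), HasDerivAt v (u x) x)
    (hg : ∀ x > (0 : ℝ), HasDerivAt g (g' x) x) (h : ∀ x > (0 : ℝ), u (x + 1) - u x = g' x) :
    ∃ d : ℝ, ∀ x > (0 : ℝ), v (x + 1) - v x = g x + d := by
  refine ⟨v (1 + 1) - v 1 - g 1, fun x hx => ?_⟩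
  have := eq_of_hasDerivAt_zero_Ioi (f := fun x => v (x + 1) - v x - g x) (fun y hy => by
    have := ((hv (y + 1) (by linarith)).shift_one.sub (hv y hy)).sub (hg y hy)
    rwa [h y hy, sub_self] at this) x hx 1 one_pos
  linarith

/-- Prepending a function to a tower of derivatives, up to a constant. -/
theorem exists_isDerivTower_lift {U F : ℕ → ℝ → ℝ} (hU : IsDerivTower U) (hF : IsDerivTower F)
    (p : ℕ) (h : ∀ x > (0 : ℝ), U 0 (x + 1) - U 0 x = F p x) :
    ∃ V : ℕ → ℝ → ℝ, IsDerivTower V ∧ V 0 1 = 0 ∧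
      (∀ x > (0 : ℝ), V 0 (x + 1) - V 0 x = F 0 x) ∧ ∀ j, V (p + 1 + j) = U (1 + j) := by
  induction p generalizing U with
  | zero =>
    refine ⟨fun k x => U k x - if k = 0 then U 0 1 else 0, ?_, by simp, ?_, ?_⟩
    · intro k x hx
      simpa using (hU k x hx).sub_const (if k = 0 then U 0 1 else 0)
    · intro x hx
      simpa using h x hx
    · intro j
      funext x
      simp
  | succ p ih =>
    obtain ⟨v, hv⟩ := exists_hasDerivAt_Ioi (u := U 0)
      fun x hx => (hU 0 x hx).continuousAt.continuousWithinAt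
    obtain ⟨d, hd⟩ := exists_fdiff_sub_eq_const hv (hF p) h
    have hex := ih (U := fun k x => match k with
        | 0 => v x - d * x
        | 1 => U 0 x - d
        | k + 2 => U (k + 1) x) ?_ ?_
    · obtain ⟨V, hV, hV1, hVd, hVU⟩ := hex
      refine ⟨V, hV, hV1, hVd, fun j => ?_⟩
      rw [show p + 1 + 1 + j = p + 1 + (j + 1) by ring, hVU, show 1 + (j + 1) = j + 2 by ring,
        show 1 + j = j + 1 by ring]
    · rintro (_ | _ | k) x hx
      · exact ((hv x hx).sub ((hasDerivAt_id x).const_mul d)).congr_deriv (by simp)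
      · exact (hU 0 x hx).sub_const d
      · exact hU (k + 1) x hx
    · intro x hx
      have := hd x hx
      simp only
      linarith

theorem tendsto_fdiff_of_tendsto_deriv {v u : ℝ → ℝ}
    (hv : ∀ x > (0 : ℝ), HasDerivAt v (u x) x) (hu : Tendsto u atTop (nhds 0)) :
    Tendsto (fun x => v (x + 1) - v x) atTop (nhds 0) := by
  rw [Metric.tendsto_atTop] at hu ⊢
  intro ε hε
  obtain ⟨N, hN⟩ := hu ε hε
  refine ⟨max N 1, fun x hx => ?_⟩
  have hx1 : 1 ≤ x := (le_max_right _ _).trans hx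
  obtain ⟨c, hc, hcv⟩ := exists_hasDerivAt_eq_slope v u (show x < x + 1 by linarith)
    (fun y hy => (hv y (by linarith [hy.1])).continuousAt.continuousWithinAt)
    (fun y hy => hv y (by linarith [hy.1]))
  rw [add_sub_cancel_left, div_one] at hcv
  rw [← hcv]
  exact hN c (((le_max_left _ _).trans hx).trans hc.1.le)

/-- `F` is the tower of derivatives of the logarithm of the `m`-th multiple gamma function. -/
def IsLogMultipleGammaTower (m : ℕ) (F : ℕ → ℝ → ℝ) : Prop :=
  IsDerivTower F ∧ F 0 1 = 0 ∧ ∀ j, ∀ x > (0 : ℝ), F (m + 1 + j) x = polyGammaSeries m j x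

theorem isLogMultipleGammaTower_zero : IsLogMultipleGammaTower 0 (fun k x => match k with
    | 0 => Real.log x
    | k + 1 => polyGammaSeries 0 k x) := by
  refine ⟨?_, by simp, fun j x _ => by rw [show 0 + 1 + j = j + 1 by ring]⟩
  rintro (_ | k) x hx
  · simpa [polyGammaSeries, shiftedPowSeries_iterPartialSum_zero] using Real.hasDerivAt_log hx.ne'
  · exact isDerivTower_polyGammaSeries 0 k x hx

theorem IsLogMultipleGammaTower.exists_succ {m : ℕ} {F : ℕ → ℝ → ℝ}
    (hF : IsLogMultipleGammaTower m F) :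
    ∃ V, IsLogMultipleGammaTower (m + 1) V ∧ ∀ x > (0 : ℝ), V 0 (x + 1) - V 0 x = F 0 x := by
  obtain ⟨hF, -, hFm⟩ := hF
  have hP := isDerivTower_polyGammaSeries (m + 1)
  obtain ⟨w, hw⟩ := exists_hasDerivAt_Ioi (u := polyGammaSeries (m + 1) 0)
    fun x hx => (hP 0 x hx).continuousAt.continuousWithinAt
  obtain ⟨d, hd⟩ := exists_fdiff_sub_eq_const hw (isDerivTower_polyGammaSeries m 0)
    fun x hx => polyGammaSeries_succ_sub m 0 hx
  have hd0 : d = 0 := by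
    have h1 := tendsto_fdiff_of_tendsto_deriv hw (tendsto_polyGammaSeries_atTop (m + 1) 0)
    have h2 := (tendsto_polyGammaSeries_atTop m 0).add_const d
    rw [zero_add] at h2
    refine tendsto_nhds_unique h2 (h1.congr' ?_)
    filter_upwards [eventually_gt_atTop 0] with x hx using hd x hx
  have hex := exists_isDerivTower_lift (U := fun k x => match k with
      | 0 => w x
      | k + 1 => polyGammaSeries (m + 1) k x) (F := F) ?_ hF (m + 1) ?_
  · obtain ⟨V, hV, hV1, hVd, hVU⟩ := hex
    refine ⟨V, ⟨hV, hV1, fun j x _ => ?_⟩, hVd⟩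
    rw [hVU, show 1 + j = j + 1 by ring]
  · rintro (_ | k) x hx
    · exact hw x hx
    · exact hP k x hx
  · intro x hx
    have := hd x hx
    rw [hd0, add_zero] at this
    exact this.trans (hFm 0 x hx).symm

/-- A tower of logarithms of multiple gamma functions, one for each order. -/
noncomputable def logMultipleGammaTower : (m : ℕ) → {F // IsLogMultipleGammaTower m F}
  | 0 => ⟨_, isLogMultipleGammaTower_zero⟩
  | m + 1 => ⟨_, (logMultipleGammaTower m).2.exists_succ.choose_spec.1⟩

theorem logMultipleGammaTower_succ_sub (m : ℕ) {x : ℝ} (hx : 0 < x) :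
    (logMultipleGammaTower (m + 1)).1 0 (x + 1) - (logMultipleGammaTower (m + 1)).1 0 x
      = (logMultipleGammaTower m).1 0 x :=
  (logMultipleGammaTower m).2.exists_succ.choose_spec.2 x hx

theorem IsDerivTower.iteratedDerivWithin_eq {F : ℕ → ℝ → ℝ} (hF : IsDerivTower F) {f : ℝ → ℝ}
    (hf : ∀ x > (0 : ℝ), f x = F 0 x) (k : ℕ) :
    ∀ x > (0 : ℝ), iteratedDerivWithin k f (Set.Ioi 0) x = F k x :=
  (hF.contDiffOn.congr hf).isDerivTower.eqOn hF (fun x hx => by simpa using hf x hx) k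

theorem isMultipleGammaSeq_exp_logMultipleGammaTower :
    IsMultipleGammaSeq (fun m x => Real.exp ((logMultipleGammaTower m).1 0 x)) := by
  refine ⟨fun m x _ => Real.exp_pos _, fun m => ?_, fun x hx => ?_, fun m x hx => ?_,
    fun m => ?_, fun m => ?_⟩
  · exact (logMultipleGammaTower m).2.1.contDiffOn.exp
  · exact Real.exp_log hx
  · simp only
    rw [← Real.exp_add, Real.exp_eq_exp]
    have := logMultipleGammaTower_succ_sub m hx
    linarith
  · simp only [(logMultipleGammaTower m).2.2.1, Real.exp_zero]
  · obtain ⟨hF, -, hFm⟩ := (logMultipleGammaTower m).2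
    have hd : StrictMonoOn ((logMultipleGammaTower m).1 m) (Set.Ioi 0) := by
      refine strictMonoOn_of_deriv_pos (convex_Ioi 0)
        (fun x hx => (hF m x hx).continuousAt.continuousWithinAt) fun x hx => ?_
      rw [interior_Ioi] at hx
      rw [(hF m x hx).deriv]
      exact (polyGammaSeries_zero_pos m hx).trans_eq (hFm 0 x hx).symm
    exact hd.congr fun x hx =>
      (hF.iteratedDerivWithin_eq (fun y _ => Real.log_exp _) m x hx).symm

/-- If a function and all its derivatives are `1`-periodic and some derivative of positive order
vanishes, then the function is constant. -/
theorem IsDerivTower.const_of_periodic {P : ℕ → ℝ → ℝ} (hP : IsDerivTower P)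
    (hper : ∀ k, ∀ x > (0 : ℝ), P k (x + 1) = P k x) (k : ℕ)
    (hk : ∀ x > (0 : ℝ), P (k + 1) x = 0) : ∀ x > (0 : ℝ), P 0 x = P 0 1 := by
  induction k with
  | zero =>
    intro x hx
    exact eq_of_hasDerivAt_zero_Ioi (fun y hy => (hP 0 y hy).congr_deriv (hk y hy)) x hx 1 one_pos
  | succ k ih =>
    refine ih fun x hx => ?_
    have hc := eq_of_hasDerivAt_zero_Ioi
      (fun y hy => (hP (k + 1) y hy).congr_deriv (hk y hy))
    have h := eq_of_hasDerivAt_zero_Ioi (f := fun y => P k y - P (k + 1) x * y)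
      (fun y hy => by
        have := (hP k y hy).sub ((hasDerivAt_id y).const_mul (P (k + 1) x))
        refine this.congr_deriv ?_
        rw [hc y hy x hx]
        ring) (x + 1) (by linarith) x hx
    have hp := hper k x hx
    simp only [hp] at h
    linarith

/-- Uniqueness of solutions of a difference equation whose `p`-th derivative is monotone. -/
theorem IsDerivTower.eqOn_of_monotoneOn {A B F : ℕ → ℝ → ℝ} (hA : IsDerivTower A)
    (hB : IsDerivTower B) (hF : IsDerivTower F)
    (hAF : ∀ x > (0 : ℝ), A 0 (x + 1) - A 0 x = F 0 x)
    (hBF : ∀ x > (0 : ℝ), B 0 (x + 1) - B 0 x = F 0 x) (h1 : A 0 1 = B 0 1) (p : ℕ)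
    (hAm : MonotoneOn (A p) (Set.Ioi 0)) (hBm : MonotoneOn (B p) (Set.Ioi 0))
    (hFp : Tendsto (F p) atTop (nhds 0)) : ∀ x > (0 : ℝ), A 0 x = B 0 x := by
  have hAF' := hA.fdiff.eqOn hF hAF
  have hBF' := hB.fdiff.eqOn hF hBF
  have hP := hA.sub hB
  have hper : ∀ k, ∀ x > (0 : ℝ), A k (x + 1) - B k (x + 1) = A k x - B k x := by
    intro k x hx
    have e1 := hAF' k x hx
    have e2 := hBF' k x hx
    linarith
  have hpern : ∀ x > (0 : ℝ), ∀ n : ℕ, A p (x + n) - B p (x + n) = A p x - B p x := by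
    intro x hx n
    induction n with
    | zero => simp
    | succ n ih =>
      have := hper p (x + n) (by positivity)
      rw [Nat.cast_succ, ← add_assoc, this, ih]
  have hloc : ∀ x > (0 : ℝ), ∀ y, x ≤ y → y ≤ x + 1 → A p y - B p y = A p x - B p x := by
    intro x hx y hxy hyx
    have hlim : Tendsto (fun n : ℕ => F p (x + n)) atTop (nhds 0) :=
      hFp.comp (tendsto_atTop_add_const_left _ _ tendsto_natCast_atTop_atTop)
    have hle : ∀ n : ℕ, |(A p y - B p y) - (A p x - B p x)| ≤ F p (x + n) := by
      intro n
      have hy : 0 < y := hx.trans_le hxy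
      rw [← hpern x hx n, ← hpern y hy n]
      have hn : (0 : ℝ) ≤ n := n.cast_nonneg
      have e1 := hAF' p (x + n) (by positivity)
      have e2 := hBF' p (x + n) (by positivity)
      have m1 := hAm (a := x + n) (b := y + n) (Set.mem_Ioi.2 (by linarith))
        (Set.mem_Ioi.2 (by linarith)) (by linarith)
      have m2 := hAm (a := y + n) (b := x + n + 1) (Set.mem_Ioi.2 (by linarith))
        (Set.mem_Ioi.2 (by linarith)) (by linarith)
      have m3 := hBm (a := x + n) (b := y + n) (Set.mem_Ioi.2 (by linarith))
        (Set.mem_Ioi.2 (by linarith)) (by linarith)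
      have m4 := hBm (a := y + n) (b := x + n + 1) (Set.mem_Ioi.2 (by linarith))
        (Set.mem_Ioi.2 (by linarith)) (by linarith)
      rw [abs_le]
      constructor <;> linarith
    have := ge_of_tendsto' hlim hle
    exact sub_eq_zero.1 (abs_nonpos_iff.1 this)
  have hzero : ∀ x > (0 : ℝ), A (p + 1) x - B (p + 1) x = 0 := by
    intro x hx
    refine (hP p x hx).unique ((hasDerivAt_const x (A p x - B p x)).congr_of_eventuallyEq ?_)
    filter_upwards [Ioi_mem_nhds hx, Ioo_mem_nhds (show x - 1 < x by linarith)
      (show x < x + 1 by linarith)] with y hy hxy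
    rcases le_total x y with h | h
    · exact hloc x hx y h hxy.2.le
    · exact (hloc y hy x h (by linarith [hxy.1])).symm
  intro x hx
  have := hP.const_of_periodic hper p hzero x hx
  simp only [h1, sub_self] at this
  linarith

/-- Existence and uniqueness (on `(0,∞)`) of the multiple-gamma sequence. -/
theorem stmt_10 : ∃ G : ℕ → ℝ → ℝ, IsMultipleGammaSeq G ∧
    ∀ G' : ℕ → ℝ → ℝ, IsMultipleGammaSeq G' → ∀ m, ∀ x > (0 : ℝ), G' m x = G m x := by
  refine ⟨_, isMultipleGammaSeq_exp_logMultipleGammaTower, fun G' hG' m => ?_⟩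
  obtain ⟨-, -, hG0, -, -, hGmono⟩ := isMultipleGammaSeq_exp_logMultipleGammaTower
  obtain ⟨hpos, hsmooth, h0, hrec, hone, hmono⟩ := hG'
  induction m with
  | zero => exact fun x hx => (h0 x hx).trans (hG0 x hx).symm
  | succ m ih =>
    obtain ⟨hF, -, hFm⟩ := (logMultipleGammaTower m).2
    obtain ⟨hB, hB1, -⟩ := (logMultipleGammaTower (m + 1)).2
    have hA := ((hsmooth (m + 1)).log fun x hx => (hpos (m + 1) x hx).ne').isDerivTower
    have key := hA.eqOn_of_monotoneOn hB hF (fun x hx => ?_)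
      (fun x hx => logMultipleGammaTower_succ_sub m hx) ?_ (m + 1) (hmono (m + 1)).monotoneOn
      ?_ ?_
    · intro x hx
      have := key x hx
      rw [iteratedDerivWithin_zero] at this
      rw [← this, Real.exp_log (hpos _ x hx)]
    · have h1 := hpos m x hx
      have h2 := hpos (m + 1) x hx
      simp only [iteratedDerivWithin_zero]
      rw [hrec m x hx, Real.log_mul h1.ne' h2.ne', ih x hx, Real.log_exp]
      ring
    · simp only [iteratedDerivWithin_zero, hone, Real.log_one, hB1]
    · exact (hGmono (m + 1)).monotoneOn.congr
        (hB.iteratedDerivWithin_eq (fun y _ => Real.log_exp _) (m + 1))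
    · refine (tendsto_polyGammaSeries_atTop m 0).congr' ?_
      filter_upwards [eventually_gt_atTop 0] with x hx using (hFm 0 x hx).symm
end

section
/- Let (G_m) be a multiple-gamma sequence. Then for every m ∈ ℕ and every x > 0, G'_{m+1}(x) = G_{m+1}(x)·( C(x−1, m)·(ψ(x) − ψ(m+1)) + Σ_{j=0}^{m} C(x−1, j)·G'_{m+1−j}(1) ), where ψ denotes the digamma function ψ(x) = Γ'(x)/Γ(x). -/
open Finset Filter

/-! ### Smooth functions on the positive half-line -/

lemma ContDiffOn.iteratedDeriv_Ioi {f : ℝ → ℝ} {a : ℝ}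
    (hf : ContDiffOn ℝ (⊤ : ℕ∞) f (Set.Ioi a)) (n : ℕ) :
    ContDiffOn ℝ (⊤ : ℕ∞) (iteratedDeriv n f) (Set.Ioi a) := by
  induction n generalizing f with
  | zero => simpa using hf
  | succ n ih =>
    rw [iteratedDeriv_succ']
    exact ih ((contDiffOn_infty_iff_deriv_of_isOpen isOpen_Ioi).1 hf).2

lemma ContDiffOn.contDiffAt_nat_of_Ioi {f : ℝ → ℝ} {a x : ℝ}
    (hf : ContDiffOn ℝ (⊤ : ℕ∞) f (Set.Ioi a)) (hx : a < x) (n : ℕ) :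
    ContDiffAt ℝ n f x :=
  (hf.contDiffAt (Ioi_mem_nhds hx)).of_le (by exact_mod_cast le_top)

/-- If the derivative of `r` tends to zero, then so do the increments of `r` over intervals of
fixed length. -/
lemma tendsto_sub_of_tendsto_deriv {r : ℝ → ℝ} (hr : DifferentiableOn ℝ r (Set.Ioi 0))
    (h0 : Tendsto (deriv r) atTop (nhds 0)) {a b : ℝ} (ha : 0 < a) (hab : a < b) :
    Tendsto (fun n : ℕ => r (b + n) - r (a + n)) atTop (nhds 0) := by
  have key : ∀ n : ℕ, ∃ c : ℝ, (n : ℝ) ≤ c ∧ r (b + n) - r (a + n) = (b - a) * deriv r c := by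
    intro n
    have hn : (0 : ℝ) ≤ n := n.cast_nonneg
    obtain ⟨c, hc, hc'⟩ := exists_deriv_eq_slope r (a := a + n) (b := b + n) (by linarith)
      (hr.continuousOn.mono fun y hy => Set.mem_Ioi.2 (by linarith [hy.1]))
      (hr.mono fun y hy => Set.mem_Ioi.2 (by linarith [hy.1]))
    refine ⟨c, by linarith [hc.1], ?_⟩
    rw [hc', show b + n - (a + n) = b - a by ring]
    field_simp [sub_ne_zero.2 hab.ne']
  choose c hc hc' using key
  have hlim : Tendsto c atTop atTop := tendsto_atTop_mono hc tendsto_natCast_atTop_atTop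
  simp_rw [hc']
  simpa using (h0.comp hlim).const_mul (b - a)

lemma periodic_add_nat {f : ℝ → ℝ} (hper : ∀ x > 0, f (x + 1) = f x) {x : ℝ} (hx : 0 < x)
    (n : ℕ) : f (x + n) = f x := by
  induction n with
  | zero => simp
  | succ n ih => rw [← ih, ← hper (x + n) (by positivity)]; push_cast; ring_nf

lemma periodic_deriv {f : ℝ → ℝ} (hper : ∀ x > 0, f (x + 1) = f x) {x : ℝ} (hx : 0 < x) :
    deriv f (x + 1) = deriv f x := by
  rw [← deriv_comp_add_const]
  exact Filter.EventuallyEq.deriv_eq ((eventually_gt_nhds hx).mono fun y hy => hper y hy)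

/-- A smooth `1`-periodic function with constant `n`-th derivative is constant. -/
lemma const_of_iteratedDeriv_const {f : ℝ → ℝ} (n : ℕ)
    (hf : ContDiffOn ℝ (⊤ : ℕ∞) f (Set.Ioi 0))
    (hper : ∀ x > 0, f (x + 1) = f x)
    (hc : ∀ x > 0, iteratedDeriv n f x = iteratedDeriv n f 1) :
    ∀ x > 0, f x = f 1 := by
  induction n generalizing f with
  | zero => simpa using hc
  | succ n ih =>
    have hd := (contDiffOn_infty_iff_deriv_of_isOpen isOpen_Ioi).1 hf
    have h1 : ∀ x > 0, deriv f x = deriv f 1 :=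
      ih hd.2 (fun x hx => periodic_deriv hper hx) (by simpa only [iteratedDeriv_succ'] using hc)
    have h2 : deriv f 1 = 0 := by
      obtain ⟨c, hc, hc'⟩ := exists_deriv_eq_slope f (a := 1) (b := 1 + 1) (by norm_num)
        (hd.1.continuousOn.mono fun y hy => Set.mem_Ioi.2 (by linarith [hy.1]))
        (hd.1.mono fun y hy => Set.mem_Ioi.2 (by linarith [hy.1]))
      rw [← h1 c (by linarith [hc.1]), hc', hper 1 one_pos]
      simp
    intro x hx
    exact isOpen_Ioi.is_const_of_deriv_eq_zero isPreconnected_Ioi hd.1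
      (fun y hy => by simp [h1 y hy, h2]) hx (Set.mem_Ioi.2 one_pos)

/-- A smooth `1`-periodic function whose `n`-th derivative becomes monotone after adding a
function with vanishing derivative at infinity is constant. -/
lemma const_of_periodic_of_monotoneOn {f r : ℝ → ℝ} (n : ℕ)
    (hf : ContDiffOn ℝ (⊤ : ℕ∞) f (Set.Ioi 0))
    (hper : ∀ x > 0, f (x + 1) = f x)
    (hr : DifferentiableOn ℝ r (Set.Ioi 0)) (h0 : Tendsto (deriv r) atTop (nhds 0))
    (hmono : MonotoneOn (fun x => iteratedDeriv n f x + r x) (Set.Ioi 0)) :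
    ∀ x > 0, f x = f 1 := by
  have hper' : ∀ x > 0, iteratedDeriv n f (x + 1) = iteratedDeriv n f x := by
    intro x hx
    rw [← congrFun (iteratedDeriv_comp_add_const n f 1) x]
    exact Filter.EventuallyEq.iteratedDeriv_eq n
      ((eventually_gt_nhds hx).mono fun y hy => hper y hy)
  have hle : ∀ a > 0, ∀ b, a < b → iteratedDeriv n f a ≤ iteratedDeriv n f b := by
    intro a ha b hab
    have hb : 0 < b := ha.trans hab
    have h := (tendsto_sub_of_tendsto_deriv hr h0 ha hab).const_add
      (iteratedDeriv n f b - iteratedDeriv n f a)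
    have := ge_of_tendsto' h (b := 0) fun k => by
      have := hmono (Set.mem_Ioi.2 (by positivity : 0 < a + k))
        (Set.mem_Ioi.2 (by positivity : 0 < b + k)) (by linarith)
      simp only [periodic_add_nat hper' ha, periodic_add_nat hper' hb] at this
      linarith
    linarith
  refine const_of_iteratedDeriv_const n hf hper fun x hx => le_antisymm ?_ ?_
  · obtain ⟨k, hk⟩ := exists_nat_gt x
    rw [← periodic_add_nat hper' one_pos k]
    exact hle x hx _ (by linarith)
  · obtain ⟨k, hk⟩ := exists_nat_gt (1 : ℝ)
    rw [← periodic_add_nat hper' hx k]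
    exact hle 1 one_pos _ (by linarith)

/-! ### The digamma function -/

lemma differentiableAt_Gamma_of_pos {x : ℝ} (hx : 0 < x) : DifferentiableAt ℝ Real.Gamma x :=
  Real.differentiableAt_Gamma fun m => by
    have : (0 : ℝ) ≤ m := m.cast_nonneg
    linarith

lemma digamma_add_one {x : ℝ} (hx : 0 < x) : digamma (x + 1) = digamma x + 1 / x := by
  have hG := (Real.Gamma_pos_of_pos hx).ne'
  have h : deriv Real.Gamma (x + 1) = Real.Gamma x + x * deriv Real.Gamma x := by
    rw [← deriv_comp_add_const,
      Filter.EventuallyEq.deriv_eq (f := fun y => y * Real.Gamma y)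
        ((eventually_gt_nhds hx).mono fun y hy => Real.Gamma_add_one hy.ne'),
      deriv_fun_mul differentiableAt_fun_id (differentiableAt_Gamma_of_pos hx)]
    simp
  rw [digamma, digamma, h, Real.Gamma_add_one hx.ne']
  field_simp
  ring

lemma deriv_log_Gamma {x : ℝ} (hx : 0 < x) :
    deriv (Real.log ∘ Real.Gamma) x = digamma x := by
  rw [Function.comp_def, deriv.log (differentiableAt_Gamma_of_pos hx)
    (Real.Gamma_pos_of_pos hx).ne', digamma]

lemma monotoneOn_digamma : MonotoneOn digamma (Set.Ioi 0) := by
  have h := Real.convexOn_log_Gamma.monotoneOn_deriv fun x hx =>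
    (Real.differentiableAt_log (Real.Gamma_pos_of_pos hx).ne').comp x
      (differentiableAt_Gamma_of_pos hx)
  exact h.congr fun x hx => deriv_log_Gamma hx

lemma tendsto_one_div_add_nat (a : ℝ) :
    Tendsto (fun n : ℕ => 1 / (a + n)) atTop (nhds 0) :=
  tendsto_const_nhds.div_atTop (tendsto_atTop_add_const_left _ _ tendsto_natCast_atTop_atTop)

lemma tendsto_digamma_add_nat_sub {a : ℝ} (ha : 0 < a) (M : ℕ) :
    Tendsto (fun n : ℕ => digamma (a + n + M) - digamma (a + n)) atTop (nhds 0) := by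
  induction M with
  | zero => simp
  | succ M ih =>
    have h := ih.add (tendsto_one_div_add_nat (a + M))
    rw [add_zero] at h
    refine h.congr fun n => ?_
    have := digamma_add_one (x := a + n + M) (by positivity)
    push_cast
    rw [← add_assoc, this, show a + (M : ℝ) + n = a + n + M by ring]
    ring

lemma tendsto_digamma_sub {a b : ℝ} (ha : 0 < a) (hb : 0 < b) :
    Tendsto (fun n : ℕ => digamma (b + n) - digamma (a + n)) atTop (nhds 0) := by
  obtain ⟨M, hM⟩ := exists_nat_gt (a + b)
  refine tendsto_of_tendsto_of_tendsto_of_le_of_le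
    (by simpa using (tendsto_digamma_add_nat_sub hb M).neg) (tendsto_digamma_add_nat_sub ha M)
    (fun n => ?_) (fun n => ?_)
  · have := monotoneOn_digamma (Set.mem_Ioi.2 (by positivity : 0 < a + n))
      (Set.mem_Ioi.2 (by positivity : 0 < b + n + M)) (by linarith)
    simp only
    linarith
  · have := monotoneOn_digamma (Set.mem_Ioi.2 (by positivity : 0 < b + n))
      (Set.mem_Ioi.2 (by positivity : 0 < a + n + M)) (by linarith)
    simp only
    linarith

lemma sum_digamma {y : ℝ} (hy : 0 < y) (n : ℕ) :
    ∑ k ∈ Finset.range n, (1 / (1 + k : ℝ) - 1 / (y + k)) =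
      digamma y - digamma 1 - (digamma (y + n) - digamma (1 + n)) := by
  induction n with
  | zero => simp
  | succ n ih =>
    have h1 := digamma_add_one (x := y + n) (by positivity)
    have h2 := digamma_add_one (x := 1 + n) (by positivity)
    rw [Finset.sum_range_succ, ih]
    push_cast
    rw [← add_assoc, ← add_assoc, h1, h2]
    ring

/-- The Hurwitz-type series `∑ k, 1 / (x + k) ^ (n + 2)`. -/
noncomputable def hurwitzSum (n : ℕ) (x : ℝ) : ℝ := ∑' k : ℕ, 1 / (x + k) ^ (n + 2)

lemma summable_hurwitz (n : ℕ) {x : ℝ} (hx : 0 < x) :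
    Summable fun k : ℕ => 1 / (x + k) ^ (n + 2) := by
  refine ((Real.summable_one_div_nat_add_rpow x ((n + 2 : ℕ) : ℝ)).2 ?_).congr fun k => ?_
  · push_cast; linarith [n.cast_nonneg (α := ℝ)]
  · rw [Real.rpow_natCast, abs_of_pos (by positivity), add_comm x]

lemma hasDerivAt_hurwitzSum (n : ℕ) {x : ℝ} (hx : 0 < x) :
    HasDerivAt (hurwitzSum n) (-(n + 2) * hurwitzSum (n + 1) x) x := by
  have hx2 : 0 < x / 2 := by positivity
  unfold hurwitzSum
  rw [← tsum_mul_left]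
  refine hasDerivAt_tsum_of_isPreconnected (t := Set.Ioi (x / 2)) (y₀ := x)
    (u := fun k : ℕ => (n + 2 : ℝ) * (1 / (x / 2 + k) ^ (n + 1 + 2)))
    ((summable_hurwitz (n + 1) hx2).mul_left _) isOpen_Ioi isPreconnected_Ioi
    (g' := fun (k : ℕ) (y : ℝ) => -(n + 2 : ℝ) * (1 / (y + k) ^ (n + 1 + 2)))
    (fun k y hy => ?_) (fun k y hy => ?_) (Set.mem_Ioi.2 (by linarith))
    (summable_hurwitz n hx) (Set.mem_Ioi.2 (by linarith))
  · have hy' : 0 < y := hx2.trans hy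
    have hk : 0 < y + k := by positivity
    have h := (((hasDerivAt_id y).add_const (k : ℝ)).pow (n + 2)).inv (pow_pos hk _).ne'
    simp only [one_div]
    refine h.congr_deriv ?_
    simp only [id, Pi.pow_apply, show n + 2 - 1 = n + 1 from rfl]
    push_cast
    field_simp
    ring
  · have hy' : 0 < y := hx2.trans hy
    rw [norm_mul, norm_neg, Real.norm_of_nonneg (by positivity), Real.norm_of_nonneg (by positivity)]
    have : x / 2 ≤ y := le_of_lt hy
    gcongr

lemma hasDerivAt_digamma {x : ℝ} (hx : 0 < x) : HasDerivAt digamma (hurwitzSum 0 x) x := by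
  set δ := min x 1 / 2 with hδ
  have hδ0 : 0 < δ := by positivity
  have hδx : δ < x := by
    have := min_le_left x 1
    linarith
  have hδ1 : δ < 1 := by
    have := min_le_right x 1
    linarith
  have hg : ∀ (k : ℕ) (y : ℝ), y ∈ Set.Ioi δ →
      HasDerivAt (fun y : ℝ => 1 / (1 + k : ℝ) - 1 / (y + k)) (1 / (y + k) ^ (0 + 2)) y := by
    intro k y hy
    have hy' : 0 < y := hδ0.trans hy
    have hk : y + k ≠ 0 := by positivity
    simp only [one_div]
    refine ((((hasDerivAt_id y).add_const (k : ℝ)).inv hk).const_sub _).congr_deriv ?_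
    simp [neg_div]
  have hg' : ∀ (k : ℕ) (y : ℝ), y ∈ Set.Ioi δ →
      ‖1 / (y + k) ^ (0 + 2)‖ ≤ 1 / (δ + k) ^ (0 + 2) := by
    intro k y hy
    have hy' : 0 < y := hδ0.trans hy
    have : δ ≤ y := le_of_lt hy
    rw [Real.norm_of_nonneg (by positivity)]
    gcongr
  have h1 : Summable fun k : ℕ => 1 / (1 + k : ℝ) - 1 / (1 + k) := by simp
  have hder := hasDerivAt_tsum_of_isPreconnected (summable_hurwitz 0 hδ0) isOpen_Ioi
    isPreconnected_Ioi hg hg' (Set.mem_Ioi.2 hδ1) h1 (Set.mem_Ioi.2 hδx)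
  refine (hder.add_const (digamma 1)).congr_of_eventuallyEq ?_
  filter_upwards [Ioi_mem_nhds hδx] with y hy
  have hy' : 0 < y := hδ0.trans hy
  have hs := summable_of_summable_hasDerivAt_of_isPreconnected (summable_hurwitz 0 hδ0) isOpen_Ioi
    isPreconnected_Ioi hg hg' (Set.mem_Ioi.2 hδ1) h1 hy
  have hlim := (tendsto_digamma_sub one_pos hy').const_sub (digamma y - digamma 1)
  have := tendsto_nhds_unique hs.hasSum.tendsto_sum_nat
    (hlim.congr fun n => (sum_digamma hy' n).symm)
  rw [this]
  ring

lemma iteratedDeriv_hurwitzSum (n : ℕ) {x : ℝ} (hx : 0 < x) :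
    iteratedDeriv n (hurwitzSum 0) x = (-1) ^ n * (n + 1).factorial * hurwitzSum n x := by
  induction n generalizing x with
  | zero => simp
  | succ n ih =>
    rw [iteratedDeriv_succ, Filter.EventuallyEq.deriv_eq
      ((eventually_gt_nhds hx).mono fun y hy => ih hy),
      ((hasDerivAt_hurwitzSum n hx).const_mul _).deriv, Nat.factorial_succ (n + 1)]
    push_cast
    ring

lemma iteratedDeriv_succ_digamma (n : ℕ) {x : ℝ} (hx : 0 < x) :
    iteratedDeriv (n + 1) digamma x = (-1) ^ n * (n + 1).factorial * hurwitzSum n x := by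
  rw [iteratedDeriv_succ', ← iteratedDeriv_hurwitzSum n hx]
  exact Filter.EventuallyEq.iteratedDeriv_eq n
    ((eventually_gt_nhds hx).mono fun y hy => (hasDerivAt_digamma hy).deriv)

lemma contDiffOn_digamma : ContDiffOn ℝ (⊤ : ℕ∞) digamma (Set.Ioi 0) := by
  refine contDiffOn_of_differentiableOn_deriv fun m _ => ?_
  refine DifferentiableOn.congr (f := iteratedDeriv m digamma) ?_
    fun x hx => iteratedDerivWithin_of_isOpen isOpen_Ioi hx
  cases m with
  | zero =>
    rw [iteratedDeriv_zero]
    exact fun x hx => (hasDerivAt_digamma hx).differentiableAt.differentiableWithinAt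
  | succ n =>
    refine DifferentiableOn.congr (f := fun x => (-1) ^ n * (n + 1).factorial * hurwitzSum n x) ?_
      fun x hx => iteratedDeriv_succ_digamma n hx
    exact fun x hx =>
      ((hasDerivAt_hurwitzSum n hx).const_mul _).differentiableAt.differentiableWithinAt

lemma tendsto_hurwitzSum_zero : Tendsto (hurwitzSum 0) atTop (nhds 0) := by
  have h := tendsto_tsum_of_dominated_convergence (𝓕 := atTop)
    (f := fun (x : ℝ) (k : ℕ) => 1 / (x + k) ^ (0 + 2)) (g := fun _ => 0)
    (summable_hurwitz 0 one_pos) (fun k => ?_) ?_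
  · rw [tsum_zero] at h
    exact h
  · exact tendsto_const_nhds.div_atTop
      ((tendsto_pow_atTop (by norm_num)).comp (tendsto_atTop_add_const_right _ _ tendsto_id))
  · filter_upwards [eventually_ge_atTop 1] with x hx k
    rw [Real.norm_of_nonneg (by positivity)]
    gcongr

lemma tendsto_pow_mul_hurwitzSum (n : ℕ) :
    Tendsto (fun x => x ^ n * hurwitzSum n x) atTop (nhds 0) := by
  refine tendsto_of_tendsto_of_tendsto_of_le_of_le' tendsto_const_nhds tendsto_hurwitzSum_zero
    ?_ ?_
  · filter_upwards [eventually_gt_atTop 0] with x hx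
    exact mul_nonneg (by positivity) (tsum_nonneg fun k => by positivity)
  · filter_upwards [eventually_gt_atTop 0] with x hx
    unfold hurwitzSum
    rw [← tsum_mul_left]
    refine ((summable_hurwitz n hx).mul_left _).tsum_le_tsum (fun k => ?_) (summable_hurwitz 0 hx)
    have hk : 0 < x + k := by positivity
    rw [zero_add, pow_add, mul_one_div, div_le_div_iff₀ (by positivity) (by positivity), one_mul]
    gcongr
    linarith [k.cast_nonneg (α := ℝ)]

/-! ### Generalized binomial coefficients -/

lemma gbinom_zero (x : ℝ) : gbinom x 0 = 1 := by simp [gbinom]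

lemma gbinom_succ (x : ℝ) (j : ℕ) : gbinom x (j + 1) = (x - j) / (j + 1) * gbinom x j := by
  rw [gbinom, gbinom, Finset.prod_range_succ, Nat.factorial_succ]
  push_cast
  field_simp

lemma gbinom_add_one_succ (x : ℝ) (j : ℕ) :
    gbinom (x + 1) (j + 1) = (x + 1) / (j + 1) * gbinom x j := by
  rw [gbinom, gbinom, Finset.prod_range_succ', Nat.factorial_succ]
  push_cast
  simp only [add_sub_add_right_eq_sub, sub_zero]
  field_simp

lemma gbinom_pascal (x : ℝ) (j : ℕ) :
    gbinom (x + 1) (j + 1) = gbinom x (j + 1) + gbinom x j := by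
  rw [gbinom_add_one_succ, gbinom_succ]
  field_simp
  ring

lemma gbinom_zero_succ (j : ℕ) : gbinom 0 (j + 1) = 0 := by
  simp [gbinom, Finset.prod_range_succ']

/-- The polynomial whose value at `x` is the generalized binomial coefficient `C(x - 1, j)`. -/
noncomputable def gbinomPoly (j : ℕ) : Polynomial ℝ :=
  Polynomial.C ((Nat.factorial j : ℝ)⁻¹) *
    ∏ i ∈ Finset.range j, (Polynomial.X - Polynomial.C ((i : ℝ) + 1))

lemma eval_gbinomPoly (j : ℕ) (x : ℝ) : (gbinomPoly j).eval x = gbinom (x - 1) j := by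
  rw [gbinomPoly, gbinom, Polynomial.eval_mul, Polynomial.eval_prod, Polynomial.eval_C,
    div_eq_inv_mul]
  congr 1
  refine Finset.prod_congr rfl fun i _ => ?_
  simp only [Polynomial.eval_sub, Polynomial.eval_X, Polynomial.eval_C]
  ring

lemma natDegree_gbinomPoly_le (j : ℕ) : (gbinomPoly j).natDegree ≤ j := by
  refine (Polynomial.natDegree_C_mul_le _ _).trans ((Polynomial.natDegree_prod_le _ _).trans ?_)
  simp only [Polynomial.natDegree_X_sub_C]
  simp

/-! ### Products of polynomials with the digamma function -/

lemma contDiff_polynomial_eval (P : Polynomial ℝ) (n : WithTop ℕ∞) :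
    ContDiff ℝ n fun x => P.eval x := by
  simpa using P.contDiff_aeval (𝕜 := ℝ) n

lemma iteratedDeriv_polynomial_eval (P : Polynomial ℝ) (n : ℕ) :
    iteratedDeriv n (fun x => P.eval x) = fun x => (Polynomial.derivative^[n] P).eval x := by
  induction n generalizing P with
  | zero => simp
  | succ n ih =>
    rw [iteratedDeriv_succ', Function.iterate_succ_apply, ← ih]
    congr 1
    ext x
    exact P.deriv

lemma tendsto_eval_mul_hurwitzSum {P : Polynomial ℝ} {n : ℕ} (hP : P.natDegree ≤ n) :
    Tendsto (fun x => P.eval x * hurwitzSum n x) atTop (nhds 0) := by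
  have h := (P.isBigO_atTop_of_degree_le (Polynomial.X ^ n) (by
    rw [Polynomial.degree_X_pow]
    exact Polynomial.degree_le_of_natDegree_le hP)).mul
      (Asymptotics.isBigO_refl (hurwitzSum n) atTop)
  refine h.trans_tendsto ?_
  simpa using tendsto_pow_mul_hurwitzSum n

lemma tendsto_iteratedDeriv_eval_mul_digamma {P : Polynomial ℝ} {m : ℕ} (hP : P.natDegree ≤ m) :
    Tendsto (iteratedDeriv (m + 1) fun x => P.eval x * digamma x) atTop (nhds 0) := by
  have heq : ∀ᶠ x : ℝ in atTop, ∑ i ∈ Finset.range (m + 1 + 1),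
      ((m + 1).choose i : ℝ) * (Polynomial.derivative^[i] P).eval x *
        iteratedDeriv (m + 1 - i) digamma x =
      iteratedDeriv (m + 1) (fun x => P.eval x * digamma x) x := by
    filter_upwards [eventually_gt_atTop 0] with x hx
    rw [iteratedDeriv_fun_mul (contDiff_polynomial_eval P _).contDiffAt
      (contDiffOn_digamma.contDiffAt_nat_of_Ioi hx _)]
    simp only [iteratedDeriv_polynomial_eval]
  refine Tendsto.congr' heq ?_
  rw [← Finset.sum_const_zero (s := Finset.range (m + 1 + 1))]
  refine tendsto_finsetSum _ fun i hi => ?_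
  obtain hi | rfl := Nat.lt_succ_iff_lt_or_eq.1 (Finset.mem_range.1 hi)
  · obtain ⟨n, rfl⟩ := Nat.exists_eq_add_of_le (Nat.lt_succ_iff.1 hi)
    have hdeg : (Polynomial.derivative^[i] P).natDegree ≤ n := by
      have := P.natDegree_iterate_derivative i
      omega
    have h := (tendsto_eval_mul_hurwitzSum hdeg).const_mul
      (((i + n + 1).choose i : ℝ) * ((-1) ^ n * (n + 1).factorial))
    rw [mul_zero] at h
    refine h.congr' ?_
    filter_upwards [eventually_gt_atTop 0] with x hx
    rw [show i + n + 1 - i = n + 1 by omega, iteratedDeriv_succ_digamma n hx]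
    ring
  · rw [Polynomial.iterate_derivative_eq_zero (by omega)]
    simp

/-! ### The explicit expression for the logarithmic derivatives -/

/-- The explicit expression for the logarithmic derivative of `G (m + 1)`, where `c j` stands for
the value at `1` of the logarithmic derivative of `G j`. -/
noncomputable def logDerivFormula (c : ℕ → ℝ) (m : ℕ) (x : ℝ) : ℝ :=
  gbinom (x - 1) m * (digamma x - digamma (m + 1)) +
    ∑ j ∈ Finset.range (m + 1), gbinom (x - 1) j * c (m + 1 - j)

lemma logDerivFormula_one (c : ℕ → ℝ) (m : ℕ) : logDerivFormula c m 1 = c (m + 1) := by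
  rw [logDerivFormula, Finset.sum_range_succ', sub_self]
  cases m <;> simp [gbinom_zero_succ, gbinom_zero]

lemma logDerivFormula_zero_add_one (c : ℕ → ℝ) {x : ℝ} (hx : 0 < x) :
    logDerivFormula c 0 (x + 1) = logDerivFormula c 0 x + 1 / x := by
  simp only [logDerivFormula, digamma_add_one hx, zero_add, Finset.sum_range_one, gbinom_zero]
  ring

lemma logDerivFormula_succ_add_one (c : ℕ → ℝ) (m : ℕ) {x : ℝ} (hx : 0 < x) :
    logDerivFormula c (m + 1) (x + 1) = logDerivFormula c (m + 1) x + logDerivFormula c m x := by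
  obtain ⟨y, rfl⟩ : ∃ y, x = y + 1 := ⟨x - 1, by ring⟩
  have hsum : ∑ j ∈ Finset.range (m + 1 + 1), gbinom (y + 1) j * c (m + 1 + 1 - j) =
      ∑ j ∈ Finset.range (m + 1 + 1), gbinom y j * c (m + 1 + 1 - j) +
        ∑ j ∈ Finset.range (m + 1), gbinom y j * c (m + 1 - j) := by
    rw [Finset.sum_range_succ', Finset.sum_range_succ' (n := m + 1)]
    simp only [gbinom_pascal, gbinom_zero, Nat.add_sub_add_right, add_mul, Finset.sum_add_distrib]
    ring
  have hbin := gbinom_add_one_succ y m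
  have hdig := digamma_add_one (x := (m : ℝ) + 1) (by positivity)
  simp only [logDerivFormula, add_sub_cancel_right, hsum, digamma_add_one hx]
  push_cast
  rw [hdig]
  have h1 : gbinom (y + 1) (m + 1) * (1 / (y + 1)) = gbinom y m * (1 / (m + 1)) := by
    rw [hbin]
    field_simp
  have h2 := gbinom_pascal y m
  linear_combination h1 + (digamma (y + 1) - (digamma (m + 1) + 1 / (m + 1))) * h2

lemma logDerivFormula_eq_eval (c : ℕ → ℝ) (m : ℕ) : ∃ Q : Polynomial ℝ, Q.natDegree ≤ m ∧
    logDerivFormula c m = fun x => (gbinomPoly m).eval x * digamma x + Q.eval x := by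
  refine ⟨-Polynomial.C (digamma (m + 1)) * gbinomPoly m + ∑ j ∈ Finset.range (m + 1),
    Polynomial.C (c (m + 1 - j)) * gbinomPoly j, ?_, ?_⟩
  · refine Polynomial.natDegree_add_le_of_degree_le ?_
      (Polynomial.natDegree_sum_le_of_forall_le _ _ fun j hj => ?_)
    · rw [← Polynomial.C_neg]
      exact (Polynomial.natDegree_C_mul_le _ _).trans (natDegree_gbinomPoly_le m)
    · exact (Polynomial.natDegree_C_mul_le _ _).trans
        ((natDegree_gbinomPoly_le j).trans (Nat.lt_succ_iff.1 (Finset.mem_range.1 hj)))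
  · ext x
    simp only [logDerivFormula, Polynomial.eval_add, Polynomial.eval_mul, Polynomial.eval_neg,
      Polynomial.eval_C, Polynomial.eval_finsetSum, eval_gbinomPoly]
    simp only [mul_comm (c _)]
    ring

lemma contDiffOn_logDerivFormula (c : ℕ → ℝ) (m : ℕ) :
    ContDiffOn ℝ (⊤ : ℕ∞) (logDerivFormula c m) (Set.Ioi 0) := by
  obtain ⟨Q, -, hQ⟩ := logDerivFormula_eq_eval c m
  rw [hQ]
  exact ((contDiff_polynomial_eval _ _).contDiffOn.mul contDiffOn_digamma).add
    (contDiff_polynomial_eval _ _).contDiffOn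

lemma tendsto_iteratedDeriv_logDerivFormula (c : ℕ → ℝ) (m : ℕ) :
    Tendsto (iteratedDeriv (m + 1) (logDerivFormula c m)) atTop (nhds 0) := by
  obtain ⟨Q, hQdeg, hQ⟩ := logDerivFormula_eq_eval c m
  refine (tendsto_iteratedDeriv_eval_mul_digamma (natDegree_gbinomPoly_le m)).congr' ?_
  filter_upwards [eventually_gt_atTop 0] with x hx
  rw [hQ, iteratedDeriv_fun_add ((contDiff_polynomial_eval _ _).contDiffAt.mul
    (contDiffOn_digamma.contDiffAt_nat_of_Ioi hx _)) (contDiff_polynomial_eval _ _).contDiffAt,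
    iteratedDeriv_polynomial_eval, Polynomial.iterate_derivative_eq_zero (by omega)]
  simp

/-! ### Multiple gamma sequences -/

namespace IsMultipleGammaSeq

variable {G : ℕ → ℝ → ℝ}

lemma contDiffOn_log (hG : IsMultipleGammaSeq G) (m : ℕ) :
    ContDiffOn ℝ (⊤ : ℕ∞) (fun x => Real.log (G m x)) (Set.Ioi 0) :=
  (hG.2.1 m).log fun x hx => (hG.1 m x hx).ne'

lemma contDiffOn_deriv_log (hG : IsMultipleGammaSeq G) (m : ℕ) :
    ContDiffOn ℝ (⊤ : ℕ∞) (deriv fun x => Real.log (G m x)) (Set.Ioi 0) :=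
  ((contDiffOn_infty_iff_deriv_of_isOpen isOpen_Ioi).1 (hG.contDiffOn_log m)).2

lemma differentiableAt (hG : IsMultipleGammaSeq G) (m : ℕ) {x : ℝ} (hx : 0 < x) :
    DifferentiableAt ℝ (G m) x :=
  ((hG.2.1 m).contDiffAt (Ioi_mem_nhds hx)).differentiableAt (by simp)

lemma deriv_log (hG : IsMultipleGammaSeq G) (m : ℕ) {x : ℝ} (hx : 0 < x) :
    deriv (fun x => Real.log (G m x)) x = deriv (G m) x / G m x :=
  deriv.log (hG.differentiableAt m hx) (hG.1 m x hx).ne'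

lemma deriv_log_zero (hG : IsMultipleGammaSeq G) {x : ℝ} (hx : 0 < x) :
    deriv (fun x => Real.log (G 0 x)) x = 1 / x := by
  rw [Filter.EventuallyEq.deriv_eq (f := Real.log)
    ((eventually_gt_nhds hx).mono fun y hy => congrArg Real.log (hG.2.2.1 y hy)),
    Real.deriv_log, one_div]

lemma deriv_log_add_one (hG : IsMultipleGammaSeq G) (m : ℕ) {x : ℝ} (hx : 0 < x) :
    deriv (fun x => Real.log (G (m + 1) x)) (x + 1) =
      deriv (fun x => Real.log (G (m + 1) x)) x + deriv (fun x => Real.log (G m x)) x := by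
  have hd : ∀ k, DifferentiableAt ℝ (fun x => Real.log (G k x)) x := fun k =>
    (hG.differentiableAt k hx).log (hG.1 k x hx).ne'
  rw [← deriv_comp_add_const, ← deriv_fun_add (hd _) (hd _)]
  refine Filter.EventuallyEq.deriv_eq ((eventually_gt_nhds hx).mono fun y hy => ?_)
  simp only
  rw [hG.2.2.2.1 m y hy, Real.log_mul (hG.1 m y hy).ne' (hG.1 (m + 1) y hy).ne', add_comm]

lemma monotoneOn_iteratedDeriv_deriv_log (hG : IsMultipleGammaSeq G) (m : ℕ) :
    MonotoneOn (iteratedDeriv m (deriv fun x => Real.log (G (m + 1) x))) (Set.Ioi 0) := by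
  rw [← iteratedDeriv_succ']
  exact (hG.2.2.2.2.2 (m + 1)).monotoneOn.congr
    fun x hx => iteratedDerivWithin_of_isOpen isOpen_Ioi hx

lemma deriv_log_eq_logDerivFormula (hG : IsMultipleGammaSeq G) (m : ℕ) {x : ℝ} (hx : 0 < x) :
    deriv (fun x => Real.log (G (m + 1) x)) x = logDerivFormula (fun k => deriv (G k) 1) m x := by
  set c : ℕ → ℝ := fun k => deriv (G k) 1
  set h : ℝ → ℝ := deriv fun x => Real.log (G (m + 1) x) with hh
  have hper : ∀ x > 0, h (x + 1) - logDerivFormula c m (x + 1) = h x - logDerivFormula c m x := by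
    intro x hx
    rw [hh, hG.deriv_log_add_one m hx]
    cases m with
    | zero => rw [hG.deriv_log_zero hx, logDerivFormula_zero_add_one c hx]; ring
    | succ m =>
      rw [hG.deriv_log_eq_logDerivFormula m hx, logDerivFormula_succ_add_one c m hx]; ring
  have hF := contDiffOn_logDerivFormula c m
  have hconst := const_of_periodic_of_monotoneOn (r := iteratedDeriv m (logDerivFormula c m)) m
    ((hG.contDiffOn_deriv_log (m + 1)).sub hF) hper
    ((hF.iteratedDeriv_Ioi m).differentiableOn (by simp))
    (by rw [← iteratedDeriv_succ]; exact tendsto_iteratedDeriv_logDerivFormula c m)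
    ((hG.monotoneOn_iteratedDeriv_deriv_log m).congr fun y hy => by
      rw [iteratedDeriv_fun_sub ((hG.contDiffOn_deriv_log (m + 1)).contDiffAt_nat_of_Ioi hy m)
        (hF.contDiffAt_nat_of_Ioi hy m), sub_add_cancel]) x hx
  have h1 : h 1 = c (m + 1) := by
    rw [hh, hG.deriv_log (m + 1) one_pos, hG.2.2.2.2.1, div_one]
  rw [logDerivFormula_one] at hconst
  exact sub_eq_zero.1 (hconst.trans (sub_eq_zero.2 h1))

end IsMultipleGammaSeq

/-- Explicit expression for the first derivative of the multiple gamma functions. -/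
theorem stmt_12 (G : ℕ → ℝ → ℝ) (hG : IsMultipleGammaSeq G) (m : ℕ) (x : ℝ) (hx : 0 < x) :
    deriv (G (m + 1)) x = G (m + 1) x *
      (gbinom (x - 1) m * (digamma x - digamma (m + 1)) +
        ∑ j ∈ Finset.range (m + 1), gbinom (x - 1) j * deriv (G (m + 1 - j)) 1) := by
  have h := hG.deriv_log_eq_logDerivFormula m hx
  rw [hG.deriv_log (m + 1) hx, div_eq_iff (hG.1 (m + 1) x hx).ne'] at h
  rw [h, mul_comm, logDerivFormula]
end
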